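/- arXiv:1309.0124 — 5 statements merged into one kernel-verified Lean document; each statement's English description precedes it below -/
import Mathlib

section
/- (Kahn) Let (G_n)_{n ≥ 0} be a sequence of finite simple graphs, each with minimum degree at least one, where G_n has v_n vertices and matching number ν_n (the size of a largest matching). If v_n → ∞ and ν_n/(v_n/2) → 1 as n → ∞, then the matching sequence (m_k(G_n))_{k ∈ ℤ} is asymptotically normal. -/
/-- Total mass of a sequence indexed by `ℤ`. -/
noncomputable def seqTotal (a : ℤ → ℝ) : ℝ := ∑ᶠ k, a k

/-- The probability mass function obtained by normalizing the sequence `a`. -/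
noncomputable def seqPMF (a : ℤ → ℝ) (k : ℤ) : ℝ := a k / seqTotal a

/-- The mean of the random variable `X` with `P(X = k) = a k / Σ_j a j`. -/
noncomputable def seqMean (a : ℤ → ℝ) : ℝ := ∑ᶠ k : ℤ, (k : ℝ) * seqPMF a k

/-- The standard deviation of the random variable `X` with `P(X = k) = a k / Σ_j a j`. -/
noncomputable def seqStdDev (a : ℤ → ℝ) : ℝ :=
  Real.sqrt (∑ᶠ k : ℤ, ((k : ℝ) - seqMean a) ^ 2 * seqPMF a k)

/-- `P((X - μ)/σ ≤ x)` for the random variable `X` with `P(X = k) = a k / Σ_j a j`. -/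
noncomputable def seqNormalizedCDF (a : ℤ → ℝ) (x : ℝ) : ℝ :=
  ∑ᶠ k ∈ {k : ℤ | ((k : ℝ) - seqMean a) / seqStdDev a ≤ x}, seqPMF a k

/-- The cumulative distribution function of the standard normal distribution. -/
noncomputable def stdNormalCDF (x : ℝ) : ℝ :=
  ∫ t in Set.Iio x, Real.exp (-(t ^ 2) / 2) / Real.sqrt (2 * Real.pi)

/-- A family of non-negative sequences `(a n k)_{k ∈ ℤ}` is asymptotically normal if the
normalized random variable `(X_n - μ_n)/σ_n` converges in distribution to a standard normal. -/
def AsymptoticallyNormal (a : ℕ → ℤ → ℝ) : Prop :=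
  ∀ x : ℝ, Filter.Tendsto (fun n => seqNormalizedCDF (a n) x)
    Filter.atTop (nhds (stdNormalCDF x))

/-- `matchCount G k` is the number of matchings of size `k` in `G`: sets of `k` edges of `G`,
pairwise sharing no endvertex. -/
noncomputable def matchCount {V : Type*} (G : SimpleGraph V) (k : ℕ) : ℕ :=
  Nat.card {s : Finset (Sym2 V) // s.card = k ∧ (∀ e ∈ s, e ∈ G.edgeSet) ∧
    ∀ e ∈ s, ∀ f ∈ s, e ≠ f → ∀ v : V, v ∈ e → v ∉ f}

/-- The matching number of `G`: the size of a largest matching. -/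
noncomputable def matchNumber {V : Type*} (G : SimpleGraph V) : ℕ :=
  sSup {k : ℕ | 0 < matchCount G k}

section Matchings

open scoped Classical
open Finset

variable {V : Type*} [Fintype V] (G : SimpleGraph V)

/-- The finite set of all matchings of `G`. -/
noncomputable def matchings : Finset (Finset (Sym2 V)) :=
  {s | (∀ e ∈ s, e ∈ G.edgeSet) ∧ ∀ e ∈ s, ∀ f ∈ s, e ≠ f → ∀ v : V, v ∈ e → v ∉ f}

/-- No edge of `M` has an endvertex in `S`. -/
def EdgesAvoid (M : Finset (Sym2 V)) (S : Finset V) : Prop := ∀ e ∈ M, ∀ x ∈ e, x ∉ S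

variable {G}

lemma mem_matchings {s : Finset (Sym2 V)} : s ∈ matchings G ↔
    (∀ e ∈ s, e ∈ G.edgeSet) ∧ ∀ e ∈ s, ∀ f ∈ s, e ≠ f → ∀ v : V, v ∈ e → v ∉ f := by
  simp [matchings]

omit [Fintype V] in
lemma EdgesAvoid.notMem {M : Finset (Sym2 V)} {e : Sym2 V} (h : EdgesAvoid M e.toFinset) :
    e ∉ M := by
  intro he
  induction e with | _ a b =>
  exact h _ he a (by simp) (by simp)

omit [Fintype V] in
lemma edgesAvoid_union {M : Finset (Sym2 V)} {S T : Finset V} :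
    EdgesAvoid M (S ∪ T) ↔ EdgesAvoid M S ∧ EdgesAvoid M T := by
  simp only [EdgesAvoid, mem_union, not_or]
  exact ⟨fun h => ⟨fun e he x hx => (h e he x hx).1, fun e he x hx => (h e he x hx).2⟩,
    fun h e he x hx => ⟨h.1 e he x hx, h.2 e he x hx⟩⟩

lemma insert_mem_matchings {M : Finset (Sym2 V)} {e : Sym2 V} (he : e ∈ G.edgeSet)
    (hM : M ∈ matchings G) (h : EdgesAvoid M e.toFinset) : insert e M ∈ matchings G := by
  rw [mem_matchings] at hM ⊢
  simp only [EdgesAvoid, Sym2.mem_toFinset] at h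
  refine ⟨fun f hf => ?_, fun f hf f' hf' hne v hv hv' => ?_⟩
  · rcases mem_insert.1 hf with rfl | hf
    exacts [he, hM.1 _ hf]
  · rcases mem_insert.1 hf with h₁ | h₁ <;> rcases mem_insert.1 hf' with h₂ | h₂
    · exact hne (h₁.trans h₂.symm)
    · exact h _ h₂ v hv' (h₁ ▸ hv)
    · exact h _ h₁ v hv (h₂ ▸ hv')
    · exact hM.2 _ h₁ _ h₂ hne v hv hv'

lemma erase_mem_matchings {M : Finset (Sym2 V)} (e : Sym2 V) (hM : M ∈ matchings G) :
    M.erase e ∈ matchings G := by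
  rw [mem_matchings] at hM ⊢
  exact ⟨fun f hf => hM.1 _ (mem_of_mem_erase hf), fun f hf f' hf' =>
    hM.2 _ (mem_of_mem_erase hf) _ (mem_of_mem_erase hf')⟩

lemma edgesAvoid_erase {M : Finset (Sym2 V)} {e : Sym2 V} (hM : M ∈ matchings G) (he : e ∈ M) :
    EdgesAvoid (M.erase e) e.toFinset := by
  intro f hf x hx hxe
  rw [mem_erase] at hf
  exact (mem_matchings.1 hM).2 f hf.2 e he hf.1 x hx (Sym2.mem_toFinset.1 hxe)

/-- Adding the edge `e` is a bijection from the matchings avoiding the ends of `e` to the matchings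
containing `e`. -/
lemma sum_matchings_mem {R : Type*} [AddCommMonoid R] {e : Sym2 V} (he : e ∈ G.edgeSet)
    (f : Finset (Sym2 V) → R) :
    ∑ M ∈ matchings G with e ∈ M, f M =
      ∑ M ∈ matchings G with EdgesAvoid M e.toFinset, f (insert e M) := by
  symm
  refine sum_bij' (fun M _ => insert e M) (fun M _ => M.erase e) ?_ ?_ ?_ ?_ ?_
  · intro M hM
    rw [mem_filter] at hM ⊢
    exact ⟨insert_mem_matchings he hM.1 hM.2, mem_insert_self _ _⟩
  · intro M hM
    rw [mem_filter] at hM ⊢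
    exact ⟨erase_mem_matchings e hM.1, edgesAvoid_erase hM.1 hM.2⟩
  · intro M hM
    rw [mem_filter] at hM
    exact erase_insert hM.2.notMem
  · intro M hM
    rw [mem_filter] at hM
    exact insert_erase hM.2
  · intros; rfl

lemma empty_mem_matchings : ∅ ∈ matchings G := by simp [mem_matchings]

/-- A vertex covered by a matching has exactly one partner. -/
lemma sum_partner {R : Type*} [AddCommMonoid R] {M : Finset (Sym2 V)} (hM : M ∈ matchings G)
    (a : V) (c : R) :
    (∑ w : V, if s(a, w) ∈ M then c else 0) = if EdgesAvoid M {a} then 0 else c := by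
  split_ifs with h
  · refine sum_eq_zero fun w _ => if_neg fun hw => ?_
    exact h _ hw a (by simp) (by simp)
  · simp only [EdgesAvoid, mem_singleton] at h
    push Not at h
    obtain ⟨e, he, x, hx, rfl⟩ := h
    obtain ⟨w, rfl⟩ := Sym2.mem_iff_exists.1 hx
    rw [sum_eq_single w, if_pos he]
    · intro w' _ hw'
      refine if_neg fun h' => ?_
      refine (mem_matchings.1 hM).2 _ h' _ he ?_ x (by simp) hx
      exact fun h'' => hw' (Sym2.congr_right.1 h'')
    · simp

/-- The matching generating function of the graph obtained by deleting the vertices in `S`. -/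
noncomputable def matchSum {R : Type*} [CommSemiring R] (G : SimpleGraph V) (z : R)
    (S : Finset V) : R :=
  ∑ M ∈ matchings G with EdgesAvoid M S, z ^ M.card

lemma matchSum_rec {R : Type*} [CommSemiring R] (z : R) {S : Finset V} {a : V} (ha : a ∉ S) :
    matchSum G z S = matchSum G z (insert a S) +
      z * ∑ w : V with G.Adj a w ∧ w ∉ S, matchSum G z (insert w (insert a S)) := by
  have h1 : ∀ w, (∑ M ∈ matchings G with EdgesAvoid M S, if s(a, w) ∈ M then z ^ M.card else 0) =
      if G.Adj a w ∧ w ∉ S then z * matchSum G z (insert w (insert a S)) else 0 := by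
    intro w
    split_ifs with h
    · rw [← sum_filter, filter_filter]
      simp_rw [and_comm (a := EdgesAvoid _ S)]
      rw [← filter_filter, sum_filter, sum_matchings_mem (e := s(a, w)) h.1, ← sum_filter, matchSum,
        mul_sum, filter_filter]
      refine sum_congr ?_ ?_
      · refine filter_congr fun M hM => ?_
        have : insert w (insert a S) = (s(a, w)).toFinset ∪ S := by
          ext x; simp; tauto
        rw [this, edgesAvoid_union]
        refine and_congr_right fun _ => ?_
        simp only [EdgesAvoid, mem_insert, forall_eq_or_imp]
        refine and_iff_right ?_
        intro x hx
        rcases Sym2.mem_iff.1 hx with rfl | rfl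
        exacts [ha, h.2]
      · intro M hM
        simp only [mem_filter] at hM
        have : EdgesAvoid M (s(a, w)).toFinset := by
          have h' := hM.2
          intro e he x hx hx'
          refine h' e he x hx ?_
          simp only [Sym2.mem_toFinset, Sym2.mem_iff] at hx'
          rcases hx' with rfl | rfl <;> simp
        rw [card_insert_of_notMem this.notMem, pow_succ, mul_comm]
    · refine sum_eq_zero fun M hM => if_neg fun hw => h ?_
      rw [mem_filter] at hM
      exact ⟨(mem_matchings.1 hM.1).1 _ hw, hM.2 _ hw w (by simp)⟩
  have h2 : (∑ w, ∑ M ∈ matchings G with EdgesAvoid M S,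
      if s(a, w) ∈ M then z ^ M.card else 0) =
      ∑ M ∈ matchings G with EdgesAvoid M S, if EdgesAvoid M {a} then 0 else z ^ M.card := by
    rw [sum_comm]
    exact sum_congr rfl fun M hM => sum_partner (mem_filter.1 hM).1 a _
  rw [mul_sum, sum_filter, ← sum_congr rfl (fun w _ => h1 w), h2, matchSum, matchSum]
  have h3 : ∀ M : Finset (Sym2 V), EdgesAvoid M (insert a S) ↔ EdgesAvoid M S ∧ EdgesAvoid M {a} :=
    fun M => by rw [insert_eq, edgesAvoid_union, and_comm]
  simp_rw [h3]
  rw [← filter_filter, sum_filter (p := fun M => EdgesAvoid M {a}), ← sum_add_distrib]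
  refine sum_congr rfl fun M _ => ?_
  split_ifs <;> simp

end Matchings

section MatchSum

open scoped Classical
open Finset

variable {V : Type*} [Fintype V] (G : SimpleGraph V)

lemma matchSum_univ {R : Type*} [CommSemiring R] (z : R) : matchSum G z univ = 1 := by
  have : ((matchings G).filter fun M => EdgesAvoid M univ) = {∅} := by
    ext M
    simp only [mem_filter, mem_singleton]
    constructor
    · rintro ⟨_, h⟩
      refine eq_empty_of_forall_notMem fun e he => ?_
      exact h e he _ (Sym2.out_fst_mem e) (mem_univ _)
    · rintro rfl
      exact ⟨empty_mem_matchings, by simp [EdgesAvoid]⟩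
  simp [matchSum, this]

/-- **Heilmann–Lieb**: the matching generating functions of `G` and its induced subgraphs do not
vanish at `t ^ 2` when `t` lies in the open right half-plane. -/
lemma matchSum_sq_ne_zero {t : ℂ} (ht : 0 < t.re) (S : Finset V) :
    matchSum G (t ^ 2) S ≠ 0 ∧
      ∀ a ∉ S, 0 < (matchSum G (t ^ 2) S / (t * matchSum G (t ^ 2) (insert a S))).re := by
  have hpos : ∀ x : ℂ, 0 < x.re → 0 < x⁻¹.re := fun x hx => by
    rw [Complex.inv_re]
    exact div_pos hx (Complex.normSq_pos.2 fun h => by simp [h] at hx)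
  have ht0 : t ≠ 0 := fun h => by simp [h] at ht
  induction hS : #Sᶜ using Nat.strong_induction_on generalizing S with
  | _ n ih =>
    have key : ∀ a ∉ S,
        0 < (matchSum G (t ^ 2) S / (t * matchSum G (t ^ 2) (insert a S))).re := by
      intro a ha
      have hlt : #(insert a S)ᶜ < n := by
        rw [← hS]
        refine card_lt_card (ssubset_iff_of_subset ?_ |>.2 ⟨a, by simpa using ha, by simp⟩)
        exact compl_subset_compl.2 (subset_insert _ _)
      obtain ⟨h0, h1⟩ := ih _ hlt _ rfl
      have : matchSum G (t ^ 2) S / (t * matchSum G (t ^ 2) (insert a S)) = t⁻¹ +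
          ∑ w : V with G.Adj a w ∧ w ∉ S, (matchSum G (t ^ 2) (insert a S) /
            (t * matchSum G (t ^ 2) (insert w (insert a S))))⁻¹ := by
        rw [matchSum_rec _ ha, add_div, mul_sum, sum_div]
        congr 1
        · field_simp
        · refine sum_congr rfl fun w _ => ?_
          rw [inv_div]
          field_simp
      rw [this, Complex.add_re, Complex.re_sum]
      refine add_pos_of_pos_of_nonneg (hpos _ ht) (sum_nonneg fun w hw => (hpos _ (h1 w ?_)).le)
      simp only [mem_filter, mem_univ, true_and] at hw
      simp [hw.2, hw.1.ne']
    refine ⟨?_, key⟩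
    by_cases hu : S = univ
    · rw [hu, matchSum_univ]
      exact one_ne_zero
    · obtain ⟨a, ha⟩ : ∃ a, a ∉ S := by simpa [eq_univ_iff_forall] using hu
      intro h
      simpa [h] using key a ha

lemma matchSum_one_nonneg (S : Finset V) : 0 ≤ matchSum G (1 : ℝ) S := by
  simp [matchSum]

/-- The deviation, up to normalization, from independence of the events that a random matching of
`G - S` misses `a` and that it misses `u`. -/
noncomputable abbrev matchDefect (S : Finset V) (a u : V) : ℝ :=
  matchSum G 1 S * matchSum G 1 (insert u (insert a S)) -
    matchSum G 1 (insert a S) * matchSum G 1 (insert u S)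

lemma matchDefect_comm (S : Finset V) (a u : V) :
    matchDefect G S a u = matchDefect G S u a := by
  simp only [matchDefect, insert_comm u a S]
  ring

lemma abs_matchDefect_le {S : Finset V} {a u : V} (ha : a ∉ S) (hu : u ∉ S) (hau : u ≠ a) :
    |matchDefect G S a u| ≤ ∑ w : V with G.Adj a w ∧ w ∉ S,
      if w = u then matchSum G (1 : ℝ) (insert w (insert a S)) ^ 2
      else |matchDefect G (insert a S) w u| := by
  have h1 : ∑ w : V with G.Adj a w ∧ w ∉ insert u S,
      matchSum G (1 : ℝ) (insert w (insert a (insert u S))) =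
      ∑ w : V with G.Adj a w ∧ w ∉ S, if w = u then 0 else
        matchSum G (1 : ℝ) (insert u (insert w (insert a S))) := by
    simp_rw [← ite_not (_ = u)]
    rw [← sum_filter, filter_filter]
    refine sum_congr (filter_congr fun w _ => by simp; tauto) fun w _ => ?_
    rw [insert_comm a u, insert_comm w u]
  have h2 : matchDefect G S a u = ∑ w : V with G.Adj a w ∧ w ∉ S,
      if w = u then matchSum G (1 : ℝ) (insert w (insert a S)) ^ 2
      else - matchDefect G (insert a S) w u := by
    have e1 := matchSum_rec (G := G) (1 : ℝ) ha
    have e2 := matchSum_rec (G := G) (1 : ℝ) (S := insert u S) (a := a) (by simp [ha, hau.symm])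
    rw [h1, one_mul, insert_comm a u S] at e2
    rw [one_mul] at e1
    rw [matchDefect, e1, e2,
      show ∀ A X B Y : ℝ, (A + X) * B - A * (B + Y) = X * B - A * Y from fun _ _ _ _ => by ring,
      sum_mul, mul_sum, ← sum_sub_distrib]
    refine sum_congr rfl fun w _ => ?_
    split_ifs with h
    · subst h; ring
    · simp only [matchDefect]; ring
  rw [h2]
  refine (abs_sum_le_sum_abs _ _).trans (sum_le_sum fun w _ => ?_)
  split_ifs
  · rw [abs_of_nonneg (sq_nonneg _)]
  · rw [abs_neg]

lemma sum_abs_matchDefect_le (S : Finset V) {a : V} (ha : a ∉ S) :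
    ∑ u : V with u ∉ insert a S, |matchDefect G S a u| ≤
      matchSum G 1 (insert a S) * (matchSum G 1 S - matchSum G 1 (insert a S)) := by
  induction hS : #Sᶜ using Nat.strong_induction_on generalizing S a with
  | _ n ih =>
    have hlt : #(insert a S)ᶜ < n := by
      rw [← hS]
      refine card_lt_card (ssubset_iff_of_subset ?_ |>.2 ⟨a, by simpa using ha, by simp⟩)
      exact compl_subset_compl.2 (subset_insert _ _)
    calc _ ≤ ∑ u : V with u ∉ insert a S, ∑ w : V with G.Adj a w ∧ w ∉ S,
          (if w = u then matchSum G (1 : ℝ) (insert w (insert a S)) ^ 2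
          else |matchDefect G (insert a S) w u|) := by
          refine sum_le_sum fun u hu => ?_
          simp only [mem_filter, mem_univ, true_and, mem_insert, not_or] at hu
          exact abs_matchDefect_le G ha hu.2 hu.1
      _ = ∑ w : V with G.Adj a w ∧ w ∉ S, (matchSum G (1 : ℝ) (insert w (insert a S)) ^ 2 +
          ∑ u : V with u ∉ insert w (insert a S), |matchDefect G (insert a S) w u|) := by
          rw [sum_comm]
          refine sum_congr rfl fun w hw => ?_
          simp only [mem_filter, mem_univ, true_and] at hw
          have hw' : w ∈ ({u : V | u ∉ insert a S} : Finset V) := by simp [hw.2, hw.1.ne']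
          rw [← add_sum_erase _ _ hw', if_pos rfl]
          congr 1
          refine sum_congr (by ext; simp) fun u hu => if_neg ?_
          simp only [mem_filter, mem_univ, true_and, mem_insert, not_or] at hu
          exact Ne.symm hu.1
      _ ≤ ∑ w : V with G.Adj a w ∧ w ∉ S,
          matchSum G (1 : ℝ) (insert a S) * matchSum G (1 : ℝ) (insert w (insert a S)) := by
          refine sum_le_sum fun w hw => ?_
          simp only [mem_filter, mem_univ, true_and] at hw
          have := ih _ hlt (insert a S) (a := w) (by simp [hw.2, hw.1.ne']) rfl
          linarith
      _ = _ := by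
          rw [← mul_sum, matchSum_rec (G := G) (1 : ℝ) ha]
          ring

lemma abs_matchSum_adj_le {S : Finset V} {a b : V} (ha : a ∉ S) (hb : b ∉ S) (hab : G.Adj a b) :
    |matchSum G 1 S * matchSum G 1 (insert a (insert b S)) -
      matchSum G 1 (insert b S) * matchSum G 1 (insert a S)| ≤
      matchSum G (1 : ℝ) (insert b S) * matchSum G 1 (insert a (insert b S)) := by
  have hab' : a ∉ insert b S := by simp [ha, hab.ne]
  refine (abs_matchDefect_le G hb ha hab.ne).trans ?_
  have := sum_abs_matchDefect_le G (insert b S) hab'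
  have hmem : a ∈ ({w : V | G.Adj b w ∧ w ∉ S} : Finset V) := by simp [ha, hab.symm]
  rw [← add_sum_erase _ _ hmem, if_pos rfl]
  have h2 : ∑ w ∈ ({w : V | G.Adj b w ∧ w ∉ S} : Finset V).erase a,
      (if w = a then matchSum G (1 : ℝ) (insert w (insert b S)) ^ 2
      else |matchDefect G (insert b S) w a|) ≤
      ∑ w : V with w ∉ insert a (insert b S), |matchDefect G (insert b S) a w| := by
    calc _ = ∑ w ∈ ({w : V | G.Adj b w ∧ w ∉ S} : Finset V).erase a,
          |matchDefect G (insert b S) a w| := by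
          refine sum_congr rfl fun w hw => ?_
          rw [if_neg (mem_erase.1 hw).1, matchDefect_comm]
      _ ≤ _ := by
          refine sum_le_sum_of_subset_of_nonneg (fun w hw => ?_) fun _ _ _ => abs_nonneg _
          simp only [mem_erase, mem_filter, mem_univ, true_and] at hw
          simp [hw.1, hw.2.1.ne', hw.2.2]
  linarith

end MatchSum

section Variance

open scoped Classical
open Finset

variable {V : Type*} [Fintype V] (G : SimpleGraph V)

/-- The expected size of a uniformly random matching. -/
noncomputable def matchMean : ℝ := (∑ M ∈ matchings G, (#M : ℝ)) / #(matchings G)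

/-- The variance of the size of a uniformly random matching. -/
noncomputable def matchVar : ℝ :=
  (∑ M ∈ matchings G, ((#M : ℝ) - matchMean G) ^ 2) / #(matchings G)

/-- The probability that a uniformly random matching covers no vertex of `S`. -/
noncomputable def missProb (S : Finset V) : ℝ := matchSum G 1 S / #(matchings G)

lemma card_matchings_pos : (0 : ℝ) < #(matchings G) :=
  Nat.cast_pos.2 (card_pos.2 ⟨_, empty_mem_matchings⟩)

lemma matchSum_one_empty : matchSum G (1 : ℝ) ∅ = #(matchings G) := by
  simp [matchSum, EdgesAvoid]

lemma matchVar_nonneg : 0 ≤ matchVar G :=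
  div_nonneg (sum_nonneg fun _ _ => sq_nonneg _) (Nat.cast_nonneg _)

lemma matchMean_nonneg : 0 ≤ matchMean G :=
  div_nonneg (sum_nonneg fun _ _ => Nat.cast_nonneg _) (Nat.cast_nonneg _)

lemma sum_card_matchings : ∑ M ∈ matchings G, (#M : ℝ) = #(matchings G) * matchMean G := by
  rw [matchMean, mul_div_cancel₀ _ (card_matchings_pos G).ne']

lemma sum_sub_sq_matchings :
    ∑ M ∈ matchings G, ((#M : ℝ) - matchMean G) ^ 2 = #(matchings G) * matchVar G := by
  rw [matchVar, mul_div_cancel₀ _ (card_matchings_pos G).ne']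

lemma sum_sq_matchings : ∑ M ∈ matchings G, (#M : ℝ) ^ 2 =
    #(matchings G) * (matchVar G + matchMean G ^ 2) := by
  have h := sum_sub_sq_matchings G
  simp only [sub_sq, sum_add_distrib, sum_sub_distrib, sum_const, nsmul_eq_mul] at h
  rw [← sum_mul, ← mul_sum, sum_card_matchings] at h
  linear_combination h

/-- The change in `M` when toggling `e`, if possible, signed by whether `e` is present. -/
noncomputable def toggle (e : Sym2 V) (M : Finset (Sym2 V)) : ℝ :=
  (if e ∈ M then 1 else 0) - (if EdgesAvoid M e.toFinset then 1 else 0)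

variable {G}

lemma sum_toggle_mul {e : Sym2 V} (he : e ∈ G.edgeSet) (g : Finset (Sym2 V) → ℝ) :
    ∑ M ∈ matchings G, toggle e M * g M =
      ∑ M ∈ matchings G with EdgesAvoid M e.toFinset, (g (insert e M) - g M) := by
  simp only [toggle, sub_mul, ite_mul, one_mul, zero_mul, sum_sub_distrib]
  rw [← sum_filter, ← sum_filter, sum_matchings_mem he]

lemma card_matchings_avoid (S : Finset V) :
    (#{M ∈ matchings G | EdgesAvoid M S} : ℝ) = matchSum G 1 S := by
  simp [matchSum]

lemma sum_toggle_mul_self {e : Sym2 V} (he : e ∈ G.edgeSet) :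
    ∑ M ∈ matchings G, toggle e M * toggle e M = 2 * matchSum G 1 e.toFinset := by
  rw [sum_toggle_mul he, ← card_matchings_avoid, mul_comm, ← nsmul_eq_mul]
  refine sum_eq_card_nsmul fun M hM => ?_
  have h := (mem_filter.1 hM).2
  have h' : ¬ EdgesAvoid (insert e M) e.toFinset := fun h => h.notMem (mem_insert_self _ _)
  simp only [toggle, mem_insert_self, h, h', h.notMem, if_true, if_false]
  norm_num

lemma sum_toggle_mul_of_disjoint {e f : Sym2 V} (he : e ∈ G.edgeSet)
    (hd : ∀ x ∈ e, x ∉ f) :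
    ∑ M ∈ matchings G, toggle e M * toggle f M = 0 := by
  rw [sum_toggle_mul he]
  refine sum_eq_zero fun M hM => ?_
  have hne : f ≠ e := by
    rintro rfl
    exact hd _ (Sym2.out_fst_mem f) (Sym2.out_fst_mem f)
  have : EdgesAvoid (insert e M) f.toFinset ↔ EdgesAvoid M f.toFinset := by
    simp only [EdgesAvoid, mem_insert, forall_eq_or_imp, Sym2.mem_toFinset]
    exact and_iff_right hd
  simp [toggle, this, hne]

lemma sum_toggle_mul_of_meet {e f : Sym2 V} (he : e ∈ G.edgeSet) (hne : f ≠ e)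
    {x : V} (hxe : x ∈ e) (hxf : x ∈ f) :
    ∑ M ∈ matchings G, toggle e M * toggle f M =
      ∑ M ∈ matchings G with EdgesAvoid M e.toFinset,
        if EdgesAvoid M f.toFinset then 1 else 0 := by
  rw [sum_toggle_mul he]
  refine sum_congr rfl fun M hM => ?_
  have h := (mem_filter.1 hM).2
  have h1 : f ∉ M := fun hf => h _ hf x hxf (by simpa using hxe)
  have h2 : ¬ EdgesAvoid (insert e M) f.toFinset := fun h =>
    h e (mem_insert_self _ _) x hxe (by simpa using hxf)
  simp [toggle, h1, h2, hne]

/-- Cauchy–Schwarz for the number of edges of a random matching against the number of edges of `F`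
in it minus the number of edges of `F` that can be added to it. -/
lemma sq_sum_matchSum_le {F : Finset (Sym2 V)} (hF : ∀ e ∈ F, e ∈ G.edgeSet) :
    (∑ e ∈ F, matchSum G (1 : ℝ) e.toFinset) ^ 2 ≤
      (#(matchings G) * matchVar G) *
        ∑ e ∈ F, ∑ f ∈ F, ∑ M ∈ matchings G, toggle e M * toggle f M := by
  have h := sum_mul_sq_le_sq_mul_sq (matchings G) (fun M => (#M : ℝ) - matchMean G)
    (fun M => ∑ e ∈ F, toggle e M)
  rw [sum_sub_sq_matchings] at h
  have h1 : ∑ M ∈ matchings G, ((#M : ℝ) - matchMean G) * ∑ e ∈ F, toggle e M =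
      ∑ e ∈ F, matchSum G (1 : ℝ) e.toFinset := by
    simp_rw [mul_sum]
    rw [sum_comm]
    refine sum_congr rfl fun e he => ?_
    simp_rw [mul_comm _ (toggle e _)]
    rw [sum_toggle_mul (hF e he), ← card_matchings_avoid, card_eq_sum_ones, Nat.cast_sum]
    refine sum_congr rfl fun M hM => ?_
    rw [card_insert_of_notMem (mem_filter.1 hM).2.notMem]
    push_cast
    ring
  have h2 : ∑ M ∈ matchings G, (∑ e ∈ F, toggle e M) ^ 2 =
      ∑ e ∈ F, ∑ f ∈ F, ∑ M ∈ matchings G, toggle e M * toggle f M := by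
    simp_rw [sq, sum_mul_sum]
    rw [sum_comm]
    exact sum_congr rfl fun e _ => sum_comm
  rwa [h1, h2] at h

lemma sum_missProb_matching_le {N : Finset (Sym2 V)} (hN : N ∈ matchings G) :
    ∑ e ∈ N, missProb G e.toFinset ≤ 2 * matchVar G := by
  have hN' := mem_matchings.1 hN
  have h := sq_sum_matchSum_le hN'.1
  have h2 : ∑ e ∈ N, ∑ f ∈ N, ∑ M ∈ matchings G, toggle e M * toggle f M =
      2 * ∑ e ∈ N, matchSum G (1 : ℝ) e.toFinset := by
    rw [mul_sum]
    refine sum_congr rfl fun e he => ?_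
    rw [sum_eq_single_of_mem e he, sum_toggle_mul_self (hN'.1 _ he)]
    intro f hf hne
    exact sum_toggle_mul_of_disjoint (hN'.1 _ he) (hN'.2 _ he _ hf hne.symm)
  rw [h2] at h
  have hT := card_matchings_pos G
  simp only [missProb]
  rw [← sum_div, div_le_iff₀ hT]
  set w := ∑ e ∈ N, matchSum G (1 : ℝ) e.toFinset
  have hw : 0 ≤ w := sum_nonneg fun _ _ => matchSum_one_nonneg _ _
  rcases hw.eq_or_lt with hw | hw
  · rw [← hw]
    have := matchVar_nonneg G
    positivity
  · refine le_of_mul_le_mul_right ?_ hw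
    nlinarith

lemma card_uncovered {M : Finset (Sym2 V)} (hM : M ∈ matchings G) :
    #{x : V | EdgesAvoid M {x}} + 2 * #M = Fintype.card V := by
  have hM' := mem_matchings.1 hM
  have h1 : ({x : V | ¬ EdgesAvoid M {x}} : Finset V) = M.biUnion Sym2.toFinset := by
    ext x
    simp [EdgesAvoid]
  have h2 : #(M.biUnion Sym2.toFinset) = 2 * #M := by
    rw [card_biUnion, sum_const_nat (m := 2), mul_comm]
    · intro e he
      exact Sym2.card_toFinset_of_not_isDiag _ (G.not_isDiag_of_mem_edgeSet (hM'.1 e he))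
    · intro e he f hf hne
      refine disjoint_left.2 fun x hx hx' => ?_
      exact hM'.2 e he f hf hne x (by simpa using hx) (by simpa using hx')
  rw [← h2, ← h1, card_filter_add_card_filter_not, card_univ]

variable (G) in
lemma sum_missProb_singleton :
    ∑ x : V, missProb G {x} = Fintype.card V - 2 * matchMean G := by
  have hT := card_matchings_pos G
  simp only [missProb]
  rw [← sum_div, div_eq_iff hT.ne']
  simp_rw [← card_matchings_avoid, card_filter, Nat.cast_sum]
  rw [sum_comm]
  have : ∀ M ∈ matchings G, (∑ x : V, ((if EdgesAvoid M {x} then 1 else 0 : ℕ) : ℝ)) =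
      Fintype.card V - 2 * #M := by
    intro M hM
    rw [← card_uncovered hM, ← Nat.cast_sum, ← card_filter]
    push_cast
    ring
  rw [sum_congr rfl this, sum_sub_distrib, ← mul_sum, sum_card_matchings]
  simp
  ring

lemma card_meet_le {M : Finset (Sym2 V)} (hM : M ∈ matchings G) {e : Sym2 V}
    (he : e ∈ G.edgeSet) (hMe : EdgesAvoid M e.toFinset) :
    (#{f ∈ G.edgeFinset | f ≠ e ∧ (∃ x ∈ e, x ∈ f) ∧ EdgesAvoid M f.toFinset} : ℝ) ≤
      2 * (Fintype.card V - 2 * #M - 2) := by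
  induction e with | _ a b =>
  have hab : a ≠ b := G.ne_of_adj he
  set U : Finset V := {x : V | EdgesAvoid M {x}}
  have hU : ∀ {f : Sym2 V} {x : V}, EdgesAvoid M f.toFinset → x ∈ f → x ∈ U := by
    intro f x h hx
    simp only [U, mem_filter, mem_univ, true_and]
    intro e' he' y hy hyx
    rw [mem_singleton] at hyx
    exact h e' he' y hy (by simpa [hyx] using hx)
  have haU : a ∈ U := hU hMe (by simp)
  have hbU : b ∈ U.erase a := mem_erase.2 ⟨hab.symm, hU hMe (by simp)⟩
  have hcard : (#((U.erase a).erase b) : ℝ) = Fintype.card V - 2 * #M - 2 := by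
    have h1 := card_erase_add_one hbU
    have h2 := card_erase_add_one haU
    have h3 := card_uncovered hM
    have h4 : #((U.erase a).erase b) + 2 + 2 * #M = Fintype.card V := by
      simp only [U] at h1 h2 ⊢
      omega
    rw [← h4]
    push_cast
    ring
  rw [← hcard]
  have hsub : ({f ∈ G.edgeFinset | f ≠ s(a, b) ∧ (∃ x ∈ s(a, b), x ∈ f) ∧
      EdgesAvoid M f.toFinset} : Finset (Sym2 V)) ⊆
      ((U.erase a).erase b).image (fun w => s(a, w)) ∪
        ((U.erase a).erase b).image (fun w => s(b, w)) := by
    intro f hf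
    simp only [mem_filter, SimpleGraph.mem_edgeFinset] at hf
    obtain ⟨hfG, hne, ⟨x, hx, hxf⟩, hfM⟩ := hf
    obtain ⟨w, rfl⟩ := Sym2.mem_iff_exists.1 hxf
    have hw : w ∈ U := hU hfM (by simp)
    have hxw : x ≠ w := G.ne_of_adj hfG
    simp only [mem_union, mem_image, mem_erase]
    rcases Sym2.mem_iff.1 hx with rfl | rfl
    · left
      exact ⟨w, ⟨by rintro rfl; exact hne rfl, hxw.symm, hw⟩, rfl⟩
    · right
      exact ⟨w, ⟨hxw.symm, by rintro rfl; exact hne Sym2.eq_swap, hw⟩, rfl⟩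
  have : #({f ∈ G.edgeFinset | f ≠ s(a, b) ∧ (∃ x ∈ s(a, b), x ∈ f) ∧
      EdgesAvoid M f.toFinset} : Finset (Sym2 V)) ≤ 2 * #((U.erase a).erase b) := by
    refine (card_le_card hsub).trans ((card_union_le _ _).trans ?_)
    rw [two_mul]
    exact add_le_add card_image_le card_image_le
  exact_mod_cast this

lemma sum_edges_sum_matchings (g : Finset (Sym2 V) → ℝ) :
    ∑ e ∈ G.edgeFinset, ∑ M ∈ matchings G with EdgesAvoid M e.toFinset, g (insert e M) =
      ∑ M ∈ matchings G, #M * g M := by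
  rw [sum_congr rfl fun e he =>
    (sum_matchings_mem (G := G) (SimpleGraph.mem_edgeFinset.1 he) g).symm]
  simp_rw [sum_filter]
  rw [sum_comm]
  refine sum_congr rfl fun M hM => ?_
  rw [← sum_filter, sum_const, nsmul_eq_mul]
  congr 3
  ext e
  simp only [mem_filter, SimpleGraph.mem_edgeFinset]
  exact and_iff_right_of_imp ((mem_matchings.1 hM).1 e)

variable (G) in
/-- The variance is large unless a linear number of vertices is expected to be uncovered. -/
lemma matchMean_le : matchMean G ≤
    2 * matchVar G * (Fintype.card V - 2 * matchMean G + 1) := by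
  have hT := card_matchings_pos G
  have h := sq_sum_matchSum_le (G := G) (F := G.edgeFinset) (by simp)
  have h1 : ∑ e ∈ G.edgeFinset, matchSum G (1 : ℝ) e.toFinset = #(matchings G) * matchMean G := by
    have := sum_edges_sum_matchings (G := G) fun _ => 1
    simp only [mul_one, sum_card_matchings] at this
    rw [← this]
    simp [matchSum]
  have h2 : ∑ e ∈ G.edgeFinset, ∑ f ∈ G.edgeFinset, ∑ M ∈ matchings G, toggle e M * toggle f M ≤
      ∑ e ∈ G.edgeFinset, ∑ M ∈ matchings G with EdgesAvoid M e.toFinset,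
        2 * ((Fintype.card V : ℝ) - 2 * #(insert e M) + 1) := by
    refine sum_le_sum fun e he => ?_
    have heG : e ∈ G.edgeSet := SimpleGraph.mem_edgeFinset.1 he
    rw [← add_sum_erase _ _ he, sum_toggle_mul_self heG]
    calc _ ≤ 2 * matchSum G (1 : ℝ) e.toFinset + ∑ f ∈ G.edgeFinset.erase e,
          ∑ M ∈ matchings G with EdgesAvoid M e.toFinset,
            if (∃ x ∈ e, x ∈ f) ∧ EdgesAvoid M f.toFinset then (1 : ℝ) else 0 := by
          gcongr with f hf
          by_cases hd : ∃ x ∈ e, x ∈ f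
          · obtain ⟨x, hxe, hxf⟩ := hd
            rw [sum_toggle_mul_of_meet heG (mem_erase.1 hf).1 hxe hxf]
            refine sum_le_sum fun M _ => ?_
            rw [if_congr (and_iff_right ⟨x, hxe, hxf⟩) rfl rfl]
          · push Not at hd
            rw [sum_toggle_mul_of_disjoint heG hd]
            exact sum_nonneg fun _ _ => by positivity
      _ ≤ _ := by
          rw [sum_comm, ← card_matchings_avoid, card_eq_sum_ones, Nat.cast_sum, mul_sum,
            ← sum_add_distrib]
          refine sum_le_sum fun M hM => ?_
          rw [mem_filter] at hM
          have := card_meet_le hM.1 heG hM.2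
          rw [card_insert_of_notMem hM.2.notMem, ← sum_filter, sum_const, nsmul_eq_mul, mul_one]
          have h3 : #({f ∈ G.edgeFinset.erase e | (∃ x ∈ e, x ∈ f) ∧ EdgesAvoid M f.toFinset}) =
            #{f ∈ G.edgeFinset | f ≠ e ∧ (∃ x ∈ e, x ∈ f) ∧ EdgesAvoid M f.toFinset} := by
            congr 1
            ext f
            simp only [mem_filter, mem_erase]
            tauto
          rw [h3]
          push_cast
          linarith
  rw [sum_edges_sum_matchings fun M => 2 * ((Fintype.card V : ℝ) - 2 * #M + 1)] at h2
  have h3 : ∑ M ∈ matchings G, (#M : ℝ) * (2 * ((Fintype.card V : ℝ) - 2 * #M + 1)) =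
      2 * (#(matchings G) * ((Fintype.card V + 1) * matchMean G -
        2 * (matchVar G + matchMean G ^ 2))) := by
    have : ∀ M : Finset (Sym2 V), (#M : ℝ) * (2 * ((Fintype.card V : ℝ) - 2 * #M + 1)) =
      (2 * (Fintype.card V + 1)) * #M - 4 * (#M : ℝ) ^ 2 := fun M => by ring
    simp_rw [this]
    rw [sum_sub_distrib, ← mul_sum, ← mul_sum, sum_card_matchings, sum_sq_matchings]
    ring
  rw [h3] at h2
  rw [h1] at h
  have hv := matchVar_nonneg G
  have hm := matchMean_nonneg G
  have h4 := h.trans (mul_le_mul_of_nonneg_left h2 (mul_nonneg hT.le hv))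
  have h5 : matchMean G ^ 2 ≤ matchVar G * (2 * ((Fintype.card V + 1) * matchMean G -
        2 * (matchVar G + matchMean G ^ 2))) := by
    refine le_of_mul_le_mul_left ?_ (pow_pos hT 2)
    linarith
  have hu : 0 ≤ (Fintype.card V : ℝ) - 2 * matchMean G := by
    rw [← sum_missProb_singleton]
    exact sum_nonneg fun _ _ => div_nonneg (matchSum_one_nonneg _ _) hT.le
  rcases hm.eq_or_lt with hm | hm
  · rw [← hm] at hu ⊢
    simp only [mul_zero, sub_zero] at hu ⊢
    positivity
  · refine le_of_mul_le_mul_right ?_ hm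
    nlinarith [mul_nonneg hv hv]

end Variance

section PairProbabilities

open scoped Classical
open Finset

lemma sum_dyadic_le {p : ℝ} (hp : 0 ≤ p) (J : ℕ) :
    ∑ j ∈ range J, (if (1 / 2 : ℝ) ^ j ≤ p then (1 / 2 : ℝ) ^ j else 0) ≤ 2 * p := by
  suffices h : ∑ j ∈ range J, (if (1 / 2 : ℝ) ^ j ≤ p then (1 / 2 : ℝ) ^ j else 0) ≤
      max 0 (2 * p - 2 * (1 / 2 : ℝ) ^ J) by
    refine h.trans (max_le (by linarith) ?_)
    have : (0 : ℝ) ≤ (1 / 2) ^ J := by positivity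
    linarith
  induction J with
  | zero => simp
  | succ J ih =>
    rw [sum_range_succ, pow_succ]
    have h0 : (0 : ℝ) < (1 / 2) ^ J := by positivity
    split_ifs with h
    · refine le_max_of_le_right ?_
      rw [max_eq_right (by linarith)] at ih
      linarith
    · refine le_max_of_le_left ?_
      rw [max_eq_left (by linarith)] at ih
      linarith

variable {V : Type*} [Fintype V]

/-- A bound on the number of uncovered vertices. Here `p x` and `π x y` are to be thought of as the
probabilities that a random matching misses `x` and contains `xy`, and `τ` as the involution defined
by a fixed matching. -/
lemma sum_le_of_involution {p : V → ℝ} {π : V → V → ℝ} {τ : V → V} {K : ℝ}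
    (hp : ∀ x, 0 ≤ p x) (hp1 : ∀ x, p x ≤ 1) (hπ : ∀ x y, 0 ≤ π x y)
    (hsymm : ∀ x y, π x y = π y x) (hsum : ∀ x, ∑ y, π x y = 1 - p x)
    (hle : ∀ x y, π x y * (1 - p y) ≤ p x * p y) (hτ : Function.Involutive τ)
    (hK : ∑ x with τ x ≠ x, p x * p (τ x) ≤ K) (J : ℕ) :
    J * ∑ x, p x ≤ Fintype.card V + 2 * J * #{x | τ x = x} + J * 2 ^ J * K +
      4 * K * Fintype.card V := by
  set n : ℝ := (Fintype.card V : ℝ)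
  set q : ℝ := (#{x | τ x = x} : ℝ)
  have hfix : ∑ y with τ y = y, (1 - p y) ≤ q := by
    refine (sum_le_card_nsmul _ _ 1 fun y _ => by linarith [hp y]).trans ?_
    simp [q]
  have hfix' : ∑ y with τ y = y, p y ≤ q := by
    refine (sum_le_card_nsmul _ _ 1 fun y _ => hp1 y).trans ?_
    simp [q]
  have hinj := hτ.injective
  have hK0 : 0 ≤ K := (sum_nonneg fun x _ => mul_nonneg (hp _) (hp _)).trans hK
  -- the inequality at a single threshold
  have main : ∀ η : ℝ, 0 < η → η ≤ 1 / 2 →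
      ∑ x, p x ≤ 2 * q + η * n + (∑ x with τ x ≠ x ∧ η ≤ p x, p (τ x)) +
        2 * η * n * ∑ x with τ x ≠ x ∧ η ≤ p x, p (τ x) := by
    intro η hη hη2
    set H : Finset V := {x | τ x ≠ x ∧ η ≤ p x}
    set g := ∑ x ∈ H, p (τ x)
    have hrow : ∀ y, ∑ x ∈ H, π (τ x) y ≤ 1 - p y := by
      intro y
      rw [← hsum y, ← sum_image (g := τ) (f := fun z => π z y) fun a _ b _ h => hinj h]
      simp_rw [fun z => hsymm z y]
      exact sum_le_sum_of_subset_of_nonneg (subset_univ _) fun _ _ _ => hπ _ _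
    have h1 : (#H : ℝ) - g = ∑ y, ∑ x ∈ H, π (τ x) y := by
      rw [sum_comm]
      simp [hsum, g]
    have h2 : ∑ y, ∑ x ∈ H, π (τ x) y ≤ ∑ y ∈ H, (1 - p y) + q + n * (2 * η * g) := by
      rw [← sum_filter_add_sum_filter_not univ (· ∈ H), add_assoc, filter_mem_eq_inter, univ_inter]
      refine add_le_add (sum_le_sum fun y _ => hrow y) ?_
      rw [← sum_filter_add_sum_filter_not _ (fun y => τ y = y), filter_filter, filter_filter]
      refine add_le_add ?_ ?_
      · refine le_trans ?_ hfix
        refine (sum_le_sum fun y _ => hrow y).trans ?_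
        refine sum_le_sum_of_subset_of_nonneg ?_ fun y _ _ => by linarith [hp1 y]
        intro y hy
        simp only [mem_filter, mem_univ, true_and] at hy ⊢
        exact hy.2
      · have hg : 0 ≤ g := sum_nonneg fun _ _ => hp _
        refine (sum_le_card_nsmul _ _ (2 * η * g) fun y hy => ?_).trans ?_
        · simp only [mem_filter, mem_univ, true_and, H, not_and, not_le] at hy
          have hy' : p y < η := hy.1 hy.2
          rw [mul_sum]
          refine sum_le_sum fun x _ => ?_
          have e1 := hle (τ x) y
          have e2 := hπ (τ x) y
          have e3 := hp (τ x)
          nlinarith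
        · rw [nsmul_eq_mul]
          refine mul_le_mul_of_nonneg_right ?_ (by positivity)
          exact Nat.cast_le.2 (card_le_univ _)
    have h3 : ∑ x, p x ≤ ∑ x ∈ H, p x + q + η * n := by
      rw [← sum_filter_add_sum_filter_not univ (· ∈ H), add_assoc, filter_mem_eq_inter, univ_inter]
      refine add_le_add le_rfl ?_
      rw [← sum_filter_add_sum_filter_not _ (fun y => τ y = y), filter_filter, filter_filter]
      refine add_le_add ?_ ?_
      · refine le_trans (sum_le_sum_of_subset_of_nonneg ?_ fun y _ _ => hp y) hfix'
        intro y hy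
        simp only [mem_filter, mem_univ, true_and] at hy ⊢
        exact hy.2
      · refine (sum_le_card_nsmul _ _ η fun y hy => ?_).trans ?_
        · simp only [mem_filter, mem_univ, true_and, H, not_and, not_le] at hy
          exact (hy.1 hy.2).le
        · rw [nsmul_eq_mul, mul_comm]
          refine mul_le_mul_of_nonneg_left ?_ hη.le
          exact Nat.cast_le.2 (card_le_univ _)
    rw [sum_sub_distrib, sum_const, nsmul_eq_mul, mul_one] at h2
    linarith
  set η : ℕ → ℝ := fun j => (1 / 2) ^ (j + 1)
  set g : ℕ → ℝ := fun j => ∑ x with τ x ≠ x ∧ η j ≤ p x, p (τ x)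
  have hη : ∀ j, 0 < η j := fun j => by positivity
  have hη2 : ∀ j, η j ≤ 1 / 2 := fun j => by
    simp only [η, pow_succ]
    have : (1 / 2 : ℝ) ^ j ≤ 1 := pow_le_one₀ (by norm_num) (by norm_num)
    linarith
  have hηsum : ∑ j ∈ range J, η j ≤ 1 := by
    have := sum_dyadic_le (p := 1) zero_le_one (J + 1)
    rw [sum_range_succ', sum_congr rfl fun j _ => if_pos ((hη2 j).trans (by norm_num))] at this
    simp at this
    simp only [η, one_div, inv_pow]
    linarith
  have hgη : ∑ j ∈ range J, η j * g j ≤ 2 * K := by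
    calc ∑ j ∈ range J, η j * g j
        = ∑ x with τ x ≠ x, (∑ j ∈ range J, if η j ≤ p x then η j else 0) * p (τ x) := by
          simp_rw [sum_mul]
          rw [sum_comm]
          refine sum_congr rfl fun j _ => ?_
          simp only [g]
          rw [mul_sum, ← filter_filter, sum_filter (p := fun x => η j ≤ p x)]
          refine sum_congr rfl fun x _ => ?_
          split_ifs <;> simp
      _ ≤ ∑ x with τ x ≠ x, 2 * (p x * p (τ x)) := by
          refine sum_le_sum fun x _ => ?_
          rw [← mul_assoc]
          refine mul_le_mul_of_nonneg_right ?_ (hp _)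
          refine le_trans ?_ (sum_dyadic_le (hp x) (J + 1))
          rw [sum_range_succ']
          refine le_add_of_nonneg_right ?_
          positivity
      _ ≤ 2 * K := by
          rw [← mul_sum]
          linarith
  have hg : ∀ j ∈ range J, g j ≤ 2 ^ J * K := by
    intro j hj
    have h1 : η j * g j ≤ K := by
      refine le_trans ?_ hK
      simp only [g]
      rw [mul_sum]
      refine (sum_le_sum (g := fun x => p x * p (τ x)) fun x hx => ?_).trans
        (sum_le_sum_of_subset_of_nonneg ?_ fun x _ _ => mul_nonneg (hp _) (hp _))
      · exact mul_le_mul_of_nonneg_right (mem_filter.1 hx).2.2 (hp _)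
      · intro x hx
        simp only [mem_filter, mem_univ, true_and] at hx ⊢
        exact hx.1
    have h2 : g j = 2 ^ (j + 1) * (η j * g j) := by
      rw [← mul_assoc, ← mul_pow]
      norm_num
    rw [h2]
    have h3 : (2 : ℝ) ^ (j + 1) ≤ 2 ^ J :=
      pow_le_pow_right₀ (by norm_num) (Nat.succ_le_of_lt (mem_range.1 hj))
    have h4 : (0 : ℝ) ≤ 2 ^ (j + 1) := by positivity
    nlinarith
  have hJ := sum_le_sum fun j (_ : j ∈ range J) => main (η j) (hη j) (hη2 j)
  have hg' : ∑ j ∈ range J, g j ≤ J * (2 ^ J * K) := by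
    refine (sum_le_card_nsmul _ _ _ hg).trans ?_
    simp
  have e1 : ∑ j ∈ range J, 2 * η j * n * g j = 2 * n * ∑ j ∈ range J, η j * g j := by
    rw [mul_sum]
    exact sum_congr rfl fun j _ => by ring
  rw [sum_add_distrib, sum_add_distrib, sum_add_distrib, e1] at hJ
  simp only [sum_const, card_range, nsmul_eq_mul] at hJ
  have hn : 0 ≤ n := Nat.cast_nonneg _
  have e2 := mul_le_mul_of_nonneg_right hηsum hn
  rw [sum_mul] at e2
  have e3 := mul_le_mul_of_nonneg_left hgη (mul_nonneg zero_le_two hn)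
  change _ ≤ _ + _ + ∑ j ∈ range J, g j + _ at hJ
  linarith

variable (G : SimpleGraph V)

/-- The probability that a uniformly random matching contains the pair `xy`. -/
noncomputable def edgeProb (x y : V) : ℝ := if G.Adj x y then missProb G {x, y} else 0

lemma missProb_nonneg (S : Finset V) : 0 ≤ missProb G S :=
  div_nonneg (matchSum_one_nonneg _ _) (Nat.cast_nonneg _)

lemma edgeProb_nonneg (x y : V) : 0 ≤ edgeProb G x y := by
  unfold edgeProb
  split_ifs
  exacts [missProb_nonneg _ _, le_rfl]

lemma edgeProb_comm (x y : V) : edgeProb G x y = edgeProb G y x := by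
  simp only [edgeProb, G.adj_comm x y, pair_comm x y]

lemma sum_edgeProb (x : V) : ∑ y, edgeProb G x y = 1 - missProb G {x} := by
  have h := matchSum_rec (G := G) (1 : ℝ) (S := ∅) (a := x) (by simp)
  have hT := card_matchings_pos G
  rw [matchSum_one_empty] at h
  simp only [edgeProb, missProb]
  rw [← sum_filter, ← sum_div, eq_sub_iff_add_eq, ← add_div, div_eq_one_iff_eq hT.ne', h,
    add_comm, one_mul]
  simp [pair_comm]

lemma abs_missProb_adj_le {x y : V} (h : G.Adj x y) :
    |missProb G {x, y} - missProb G {x} * missProb G {y}| ≤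
      missProb G {y} * missProb G {x, y} := by
  have := abs_matchSum_adj_le G (S := ∅) (a := x) (b := y) (by simp) (by simp) h
  have hT := card_matchings_pos G
  rw [matchSum_one_empty] at this
  simp only [insert_empty_eq] at this
  rw [← div_le_div_iff_of_pos_right (pow_pos hT 2), ← abs_of_pos (pow_pos hT 2), ← abs_div,
    abs_of_pos (pow_pos hT 2)] at this
  simp only [missProb]
  refine (le_of_eq ?_).trans (this.trans_eq (by rw [div_mul_div_comm, sq]))
  congr 1
  field_simp

lemma missProb_singleton_le_one (x : V) : missProb G {x} ≤ 1 := by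
  have := sum_edgeProb G x
  have h2 := sum_nonneg fun y (_ : y ∈ univ) => edgeProb_nonneg G x y
  linarith

lemma missProb_mul_le {x y : V} (h : G.Adj x y) :
    missProb G {x} * missProb G {y} ≤ 2 * missProb G {x, y} := by
  have h1 := (abs_le.1 (abs_missProb_adj_le G h)).1
  have h2 := missProb_singleton_le_one G y
  have h3 := missProb_nonneg G {x, y}
  nlinarith

lemma edgeProb_mul_le (x y : V) :
    edgeProb G x y * (1 - missProb G {y}) ≤ missProb G {x} * missProb G {y} := by
  unfold edgeProb
  split_ifs with h
  · have h1 := (abs_le.1 (abs_missProb_adj_le G h)).2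
    linarith
  · have := mul_nonneg (missProb_nonneg G {x}) (missProb_nonneg G {y})
    linarith

variable {G} in
/-- A matching defines an involution exchanging the ends of its edges. -/
lemma exists_involution {N : Finset (Sym2 V)} (hN : N ∈ matchings G) :
    ∃ τ : V → V, Function.Involutive τ ∧ (∀ x y, x ≠ y → (τ x = y ↔ s(x, y) ∈ N)) ∧
      #{x | τ x = x} + 2 * #N = Fintype.card V := by
  have hN' := mem_matchings.1 hN
  have huniq : ∀ x y z, s(x, y) ∈ N → s(x, z) ∈ N → y = z := by
    intro x y z hy hz
    by_contra hne
    exact hN'.2 _ hy _ hz (fun h => hne (Sym2.congr_right.1 h)) x (by simp) (by simp)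
  have hdiag : ∀ x, s(x, x) ∉ N := fun x hx => G.loopless.irrefl x (hN'.1 _ hx)
  have hex : ∀ x, ∃ y, s(x, y) ∈ N ∨ (y = x ∧ ∀ z, s(x, z) ∉ N) := by
    intro x
    by_cases h : ∃ y, s(x, y) ∈ N
    · exact h.imp fun _ => Or.inl
    · exact ⟨x, Or.inr ⟨rfl, not_exists.1 h⟩⟩
  choose τ hτ using hex
  have hiff : ∀ x y, x ≠ y → (τ x = y ↔ s(x, y) ∈ N) := by
    intro x y hxy
    constructor
    · rintro rfl
      rcases hτ x with h | h
      exacts [h, absurd h.1.symm hxy]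
    · intro h
      rcases hτ x with h' | h'
      exacts [huniq _ _ _ h' h, absurd h (h'.2 _)]
  refine ⟨τ, fun x => ?_, hiff, ?_⟩
  · rcases eq_or_ne (τ x) x with h | h
    · rw [h, h]
    · exact (hiff _ _ h).2 (Sym2.eq_swap ▸ (hiff _ _ h.symm).1 rfl)
  · rw [← card_uncovered hN]
    congr 3
    ext x
    simp only [EdgesAvoid, mem_singleton]
    constructor
    · rintro h e he y hy rfl
      obtain ⟨w, rfl⟩ := Sym2.mem_iff_exists.1 hy
      have : y ≠ w := by rintro rfl; exact hdiag _ he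
      exact this (h.symm.trans ((hiff _ _ this).2 he))
    · intro h
      by_contra hne
      exact h _ ((hiff _ _ (Ne.symm hne)).1 rfl) x (by simp) rfl

variable {G} in
lemma sum_missProb_involution_le {N : Finset (Sym2 V)} (hN : N ∈ matchings G) {τ : V → V}
    (hτ : ∀ x y, x ≠ y → (τ x = y ↔ s(x, y) ∈ N)) :
    ∑ x with τ x ≠ x, missProb G {x} * missProb G {τ x} ≤ 8 * matchVar G := by
  have hN' := mem_matchings.1 hN
  have hmem : ∀ x, τ x ≠ x → s(x, τ x) ∈ N := fun x hx => (hτ _ _ hx.symm).1 rfl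
  calc ∑ x with τ x ≠ x, missProb G {x} * missProb G {τ x}
      ≤ ∑ x with τ x ≠ x, 2 * missProb G (s(x, τ x)).toFinset := by
        refine sum_le_sum fun x hx => ?_
        rw [Sym2.toFinset_mk_eq]
        exact missProb_mul_le G (hN'.1 _ (hmem x (mem_filter.1 hx).2))
    _ = ∑ e ∈ N, ∑ x with τ x ≠ x ∧ s(x, τ x) = e, 2 * missProb G e.toFinset := by
        rw [← sum_fiberwise_of_maps_to (g := fun x => s(x, τ x)) (t := N)]
        · refine sum_congr rfl fun e _ => ?_
          rw [filter_filter]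
          refine sum_congr rfl fun x hx => ?_
          rw [(mem_filter.1 hx).2.2]
        · intro x hx
          exact hmem x (mem_filter.1 hx).2
    _ ≤ ∑ e ∈ N, 2 * (2 * missProb G e.toFinset) := by
        refine sum_le_sum fun e he => ?_
        rw [sum_const, nsmul_eq_mul]
        refine mul_le_mul_of_nonneg_right ?_ (mul_nonneg zero_le_two (missProb_nonneg _ _))
        have : #({x | τ x ≠ x ∧ s(x, τ x) = e} : Finset V) ≤ #e.toFinset := by
          refine card_le_card fun x hx => ?_
          simp only [mem_filter, mem_univ, true_and] at hx
          rw [← hx.2]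
          simp
        rw [Sym2.card_toFinset_of_not_isDiag _ (G.not_isDiag_of_mem_edgeSet (hN'.1 e he))] at this
        exact_mod_cast this
    _ ≤ 8 * matchVar G := by
        rw [← mul_sum, ← mul_sum]
        linarith [sum_missProb_matching_le hN]

variable {G} in
lemma mul_expected_uncovered_le {N : Finset (Sym2 V)} (hN : N ∈ matchings G) (J : ℕ) :
    J * ((Fintype.card V : ℝ) - 2 * matchMean G) ≤
      Fintype.card V + 2 * J * (Fintype.card V - 2 * #N) + J * 2 ^ J * (8 * matchVar G) +
        32 * matchVar G * Fintype.card V := by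
  obtain ⟨τ, h1, h2, h3⟩ := exists_involution hN
  have := sum_le_of_involution (fun x => missProb_nonneg G {x}) (missProb_singleton_le_one G)
    (edgeProb_nonneg G) (edgeProb_comm G) (sum_edgeProb G) (edgeProb_mul_le G) h1
    (sum_missProb_involution_le hN h2) J
  rw [sum_missProb_singleton] at this
  have h4 : (#{x | τ x = x} : ℝ) = Fintype.card V - 2 * #N := by
    rw [← h3]
    push_cast
    ring
  rw [h4] at this
  linarith

end PairProbabilities

section VarianceTendsto

open scoped Classical
open Finset

variable {V : Type*} [Fintype V] (G : SimpleGraph V)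

lemma matchCount_eq_card (k : ℕ) : matchCount G k = #{M ∈ matchings G | #M = k} := by
  rw [matchCount, Nat.card_eq_fintype_card, Fintype.card_subtype]
  congr 1
  ext M
  simp only [mem_filter, mem_univ, true_and, mem_matchings]
  tauto

lemma exists_mem_matchings_card_eq : ∃ N ∈ matchings G, #N = matchNumber G := by
  have hne : {k : ℕ | 0 < matchCount G k}.Nonempty := by
    refine ⟨0, ?_⟩
    rw [Set.mem_ofPred_eq, matchCount_eq_card, card_pos]
    exact ⟨∅, by simp [empty_mem_matchings]⟩
  have hbdd : BddAbove {k : ℕ | 0 < matchCount G k} := by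
    refine ⟨Fintype.card (Sym2 V), fun k hk => ?_⟩
    rw [Set.mem_ofPred_eq, matchCount_eq_card, card_pos] at hk
    obtain ⟨M, hM⟩ := hk
    rw [← (mem_filter.1 hM).2]
    exact card_le_univ M
  have h := Nat.sSup_mem hne hbdd
  rw [Set.mem_ofPred_eq, matchCount_eq_card, card_pos] at h
  obtain ⟨N, hN⟩ := h
  exact ⟨N, (mem_filter.1 hN).1, (mem_filter.1 hN).2⟩

/-- If almost all vertices can be covered by a matching, then the variance of the size of a random
matching tends to infinity with the number of vertices. -/
lemma exists_forall_le_matchVar (C : ℝ) : ∃ δ : ℝ, 0 < δ ∧ ∃ n₀ : ℕ, ∀ (W : Type) [Fintype W]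
    (H : SimpleGraph W), n₀ ≤ Fintype.card W →
      (1 - δ) * (Fintype.card W : ℝ) ≤ 2 * (matchNumber H : ℝ) → C ≤ matchVar H := by
  wlog hC : 0 < C generalizing C
  · obtain ⟨δ, hδ, n₀, h⟩ := this 1 one_pos
    exact ⟨δ, hδ, n₀, fun W _ H h1 h2 => by linarith [h W H h1 h2]⟩
  set ε : ℝ := 1 / (2 * (1 + 4 * C)) with hε
  have hε0 : 0 < ε := by positivity
  obtain ⟨J, hJ⟩ := exists_nat_gt (4 * (1 + 32 * C) / ε)
  have hJ0 : (0 : ℝ) < J := lt_trans (by positivity) hJ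
  obtain ⟨n₁, hn₁⟩ := exists_nat_gt (8 * C)
  obtain ⟨n₂, hn₂⟩ := exists_nat_gt (2 ^ J * 16 * C / ε)
  refine ⟨ε / 8, by positivity, max n₁ n₂, fun W _ H hn hν => ?_⟩
  by_contra! hlt
  have hn1 : 8 * C < Fintype.card W :=
    hn₁.trans_le (Nat.cast_le.2 ((le_max_left _ _).trans hn))
  have hn2 : 2 ^ J * 16 * C / ε < Fintype.card W :=
    hn₂.trans_le (Nat.cast_le.2 ((le_max_right _ _).trans hn))
  obtain ⟨N, hN, hNcard⟩ := exists_mem_matchings_card_eq H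
  have h1 := matchMean_le H
  have h2 := mul_expected_uncovered_le hN J
  have hs := matchVar_nonneg H
  have hu : 0 ≤ (Fintype.card W : ℝ) - 2 * matchMean H := by
    rw [← sum_missProb_singleton]
    exact sum_nonneg fun _ _ => missProb_nonneg _ _
  rw [hNcard] at h2
  set n : ℝ := (Fintype.card W : ℝ)
  set u : ℝ := n - 2 * matchMean H with hu'
  set s := matchVar H
  have hμ : matchMean H = (n - u) / 2 := by rw [hu']; ring
  rw [hμ] at h1
  have h3 : s * (u + 1) ≤ C * (u + 1) := mul_le_mul_of_nonneg_right hlt.le (by linarith)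
  have h4 : ε * n ≤ u := by
    rw [hε, div_mul_eq_mul_div, one_mul, div_le_iff₀ (by positivity)]
    nlinarith
  have hn0 : 0 < n := by linarith
  rw [div_lt_iff₀ hε0] at hJ hn2
  have h5 : J * (ε * n) ≤ J * u := mul_le_mul_of_nonneg_left h4 hJ0.le
  have h6 : 2 * J * (n - 2 * matchNumber H) ≤ 2 * J * (ε / 8 * n) :=
    mul_le_mul_of_nonneg_left (by linarith) (by positivity)
  have h7 : J * 2 ^ J * (8 * s) ≤ J * 2 ^ J * (8 * C) :=
    mul_le_mul_of_nonneg_left (by linarith) (by positivity)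
  have h8 : 32 * s * n ≤ 32 * C * n := mul_le_mul_of_nonneg_right (by linarith) hn0.le
  have h9 : (4 * (1 + 32 * C)) * n ≤ J * ε * n := mul_le_mul_of_nonneg_right hJ.le hn0.le
  have h10 : J * (2 ^ J * 16 * C) < J * (n * ε) := mul_lt_mul_of_pos_left hn2 hJ0
  linarith

lemma tendsto_matchVar {V : ℕ → Type} [∀ n, Fintype (V n)] {G : ∀ n, SimpleGraph (V n)}
    {v ν : ℕ → ℕ} (hv : ∀ n, v n = Fintype.card (V n)) (hν : ∀ n, ν n = matchNumber (G n))
    (hvtop : Filter.Tendsto v Filter.atTop Filter.atTop)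
    (hasymp : Filter.Tendsto (fun n => (ν n : ℝ) / ((v n : ℝ) / 2)) Filter.atTop (nhds 1)) :
    Filter.Tendsto (fun n => matchVar (G n)) Filter.atTop Filter.atTop := by
  refine Filter.tendsto_atTop.2 fun C => ?_
  obtain ⟨δ, hδ, n₀, h⟩ := exists_forall_le_matchVar C
  filter_upwards [hvtop.eventually_ge_atTop n₀, hvtop.eventually_gt_atTop 0,
    hasymp.eventually_const_le (by linarith : 1 - δ < 1)] with n h1 h2 h3
  refine h (V n) (G n) (hv n ▸ h1) ?_
  have h4 : (0 : ℝ) < v n := Nat.cast_pos.2 h2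
  rw [le_div_iff₀ (by positivity)] at h3
  rw [← hv, ← hν]
  linarith

end VarianceTendsto

section Factorization

open scoped Classical
open Finset Polynomial

variable {V : Type*} [Fintype V] (G : SimpleGraph V)

/-- The generating polynomial of the matchings of `G`. -/
noncomputable def matchPoly : ℝ[X] := ∑ M ∈ matchings G, X ^ #M

lemma matchPoly_aeval {A : Type*} [CommSemiring A] [Algebra ℝ A] (z : A) :
    aeval z (matchPoly G) = ∑ M ∈ matchings G, z ^ #M := by
  simp [matchPoly]

lemma exists_eq_neg_sq_of_isRoot {a : ℂ} (ha : aeval a (matchPoly G) = 0) :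
    ∃ y : ℝ, a = -(y : ℂ) ^ 2 := by
  have h0 : ∀ t : ℂ, 0 < t.re → t ^ 2 ≠ a := by
    rintro t ht rfl
    refine (matchSum_sq_ne_zero G ht ∅).1 ?_
    rw [matchPoly_aeval] at ha
    simpa [matchSum, EdgesAvoid] using ha
  obtain ⟨t, rfl⟩ := IsAlgClosed.exists_pow_nat_eq a (n := 2) two_pos
  have ht : t.re = 0 := by
    rcases lt_trichotomy t.re 0 with h | h | h
    · exact absurd (neg_sq t) (h0 (-t) (by simpa using h))
    · exact h
    · exact absurd rfl (h0 t h)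
  refine ⟨t.im, ?_⟩
  conv_lhs => rw [← Complex.re_add_im t, ht]
  rw [Complex.ofReal_zero, zero_add, mul_pow, Complex.I_sq]
  ring

/-- The size of a random matching is distributed as a sum of independent Bernoulli variables. -/
lemma exists_matchPoly_eq_prod : ∃ s : Multiset ℝ, (∀ p ∈ s, 0 ≤ p ∧ p ≤ 1) ∧
    matchPoly G = C (#(matchings G) : ℝ) * (s.map fun p => C (1 - p) + C p * X).prod := by
  set P : ℂ[X] := (matchPoly G).map (algebraMap ℝ ℂ) with hP
  have heval : ∀ z : ℂ, P.eval z = ∑ M ∈ matchings G, z ^ #M := fun z => by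
    rw [hP, eval_map_algebraMap, matchPoly_aeval]
  have hT : (#(matchings G) : ℂ) ≠ 0 := by exact_mod_cast (card_matchings_pos G).ne'
  have h1 : P.eval 1 = #(matchings G) := by simp [heval]
  have hP0 : P ≠ 0 := by
    intro h
    rw [h, eval_zero] at h1
    exact hT h1.symm
  have hroot : ∀ a ∈ P.roots, ∃ y : ℝ, a = -(y : ℂ) ^ 2 := fun a ha => by
    refine exists_eq_neg_sq_of_isRoot G ?_
    rw [matchPoly_aeval, ← heval]
    exact (mem_roots hP0).1 ha
  have hfac : ∀ z : ℂ, P.eval z = P.leadingCoeff * (P.roots.map fun a => z - a).prod := by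
    intro z
    conv_lhs => rw [(IsAlgClosed.splits P).eq_prod_roots]
    simp [eval_multiset_prod, Multiset.map_map]
  refine ⟨P.roots.map fun a => 1 / (1 - a.re), ?_, ?_⟩
  · intro p hp
    obtain ⟨a, ha, rfl⟩ := Multiset.mem_map.1 hp
    obtain ⟨y, rfl⟩ := hroot a ha
    have : (-(y : ℂ) ^ 2).re = - y ^ 2 := by
      rw [← Complex.ofReal_pow, ← Complex.ofReal_neg, Complex.ofReal_re]
    rw [this, sub_neg_eq_add]
    refine ⟨by positivity, div_le_one_of_le₀ ?_ (by positivity)⟩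
    linarith [sq_nonneg y]
  · refine Polynomial.funext fun x => ?_
    have key : P.eval (x : ℂ) = #(matchings G) *
        (P.roots.map fun a => (1 - 1 / (1 - a.re) + 1 / (1 - a.re) * x : ℂ)).prod := by
      rw [← h1, hfac, hfac, mul_assoc, ← Multiset.prod_map_mul]
      congr 2
      refine Multiset.map_congr rfl fun a ha => ?_
      obtain ⟨y, rfl⟩ := hroot a ha
      have : (-(y : ℂ) ^ 2).re = - y ^ 2 := by
        rw [← Complex.ofReal_pow, ← Complex.ofReal_neg, Complex.ofReal_re]
      have h2 : (1 + (y : ℂ) ^ 2) ≠ 0 := by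
        have : (0 : ℝ) < 1 + y ^ 2 := by positivity
        exact_mod_cast this.ne'
      rw [this]
      push_cast
      rw [sub_neg_eq_add, sub_neg_eq_add]
      field_simp
      ring
    have h3 : P.eval (x : ℂ) = ((matchPoly G).eval x : ℝ) := by
      rw [heval, matchPoly]
      simp [eval_finsetSum]
    apply Complex.ofReal_injective
    rw [← h3, key, eval_mul, eval_C, Complex.ofReal_mul, Complex.ofReal_natCast,
      eval_multiset_prod]
    refine congrArg _ (Eq.trans ?_ (map_multiset_prod Complex.ofRealHom _).symm)
    simp only [Multiset.map_map]
    refine congrArg _ (Multiset.map_congr rfl fun a _ => ?_)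
    simp

lemma derivative_bernoulli_prod (s : Multiset ℝ) :
    let Q : ℝ[X] := (s.map fun p => C (1 - p) + C p * X).prod
    Q.eval 1 = 1 ∧ (derivative Q).eval 1 = s.sum ∧
      (derivative (derivative Q)).eval 1 = s.sum ^ 2 - (s.map fun p => p ^ 2).sum := by
  induction s using Multiset.induction_on with
  | empty => simp
  | cons p s ih =>
    obtain ⟨h1, h2, h3⟩ := ih
    simp only [Multiset.map_cons, Multiset.prod_cons, Multiset.sum_cons]
    generalize (s.map fun p => C (1 - p) + C p * X).prod = Q at h1 h2 h3
    simp only [derivative_mul, derivative_add, derivative_C, derivative_X, zero_mul, zero_add,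
      mul_one, eval_add, eval_mul, eval_C, eval_X, h1, h2, h3]
    refine ⟨by ring, by ring, by ring⟩

variable {G} in
lemma matchMean_eq_sum {s : Multiset ℝ} (hs : matchPoly G =
      C (#(matchings G) : ℝ) * (s.map fun p => C (1 - p) + C p * X).prod) :
    matchMean G = s.sum := by
  have hT := card_matchings_pos G
  obtain ⟨-, h2, -⟩ := derivative_bernoulli_prod s
  have h := congrArg (fun Q => (derivative Q).eval 1) hs
  simp only [matchPoly, derivative_sum, derivative_X_pow, eval_finsetSum, eval_mul, eval_C,
    eval_pow, eval_X, one_pow, mul_one, derivative_C_mul, h2, sum_card_matchings] at h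
  exact mul_left_cancel₀ hT.ne' h

variable {G} in
lemma matchVar_eq_sum {s : Multiset ℝ} (hs : matchPoly G =
      C (#(matchings G) : ℝ) * (s.map fun p => C (1 - p) + C p * X).prod) :
    matchVar G = (s.map fun p => p * (1 - p)).sum := by
  have hT := card_matchings_pos G
  obtain ⟨-, -, h3⟩ := derivative_bernoulli_prod s
  have hμ := matchMean_eq_sum hs
  have h := congrArg (fun Q => (derivative (derivative Q)).eval 1) hs
  simp only [matchPoly, derivative_sum, derivative_X_pow, eval_finsetSum, eval_mul, eval_C,
    eval_pow, eval_X, one_pow, mul_one, derivative_C_mul, h3] at h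
  have h4 : ∀ M : Finset (Sym2 V), (#M : ℝ) * ((#M - 1 : ℕ) : ℝ) = (#M : ℝ) ^ 2 - #M := by
    intro M
    rcases Nat.eq_zero_or_pos #M with h | h
    · simp [h]
    · rw [Nat.cast_sub h]
      push_cast
      ring
  simp only [h4, sum_sub_distrib, sum_sq_matchings, sum_card_matchings, hμ] at h
  have h5 : (s.map fun p => p * (1 - p)).sum = s.sum - (s.map fun p => p ^ 2).sum := by
    simp only [mul_sub, mul_one, ← sq, Multiset.sum_map_sub, Multiset.map_id']
  rw [h5]
  refine mul_left_cancel₀ hT.ne' ?_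
  linarith

end Factorization

section CentralLimit

open scoped Classical
open Finset Complex

lemma norm_multiset_prod_map_le_one {ι : Type*} {s : Multiset ι} {A : ι → ℂ}
    (hA : ∀ i ∈ s, ‖A i‖ ≤ 1) : ‖(s.map A).prod‖ ≤ 1 := by
  induction s using Multiset.induction_on with
  | empty => simp
  | cons i s ih =>
    rw [Multiset.map_cons, Multiset.prod_cons, norm_mul]
    exact mul_le_one₀ (hA i (Multiset.mem_cons_self i s)) (norm_nonneg _)
      (ih fun j hj => hA j (Multiset.mem_cons_of_mem hj))

lemma norm_multiset_prod_sub_prod_le {ι : Type*} {s : Multiset ι} {A B : ι → ℂ}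
    (hA : ∀ i ∈ s, ‖A i‖ ≤ 1) (hB : ∀ i ∈ s, ‖B i‖ ≤ 1) :
    ‖(s.map A).prod - (s.map B).prod‖ ≤ (s.map fun i => ‖A i - B i‖).sum := by
  induction s using Multiset.induction_on with
  | empty => simp
  | cons i s ih =>
    have hA' : ∀ j ∈ s, ‖A j‖ ≤ 1 := fun j hj => hA j (Multiset.mem_cons_of_mem hj)
    have hB' : ∀ j ∈ s, ‖B j‖ ≤ 1 := fun j hj => hB j (Multiset.mem_cons_of_mem hj)
    simp only [Multiset.map_cons, Multiset.prod_cons, Multiset.sum_cons]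
    have h : A i * (s.map A).prod - B i * (s.map B).prod =
        (A i - B i) * (s.map A).prod + B i * ((s.map A).prod - (s.map B).prod) := by ring
    rw [h]
    refine (norm_add_le _ _).trans (add_le_add ?_ ?_)
    · rw [norm_mul]
      exact mul_le_of_le_one_right (norm_nonneg _) (norm_multiset_prod_map_le_one hA')
    · rw [norm_mul]
      exact (mul_le_of_le_one_left (norm_nonneg _) (hB i (Multiset.mem_cons_self i s))).trans
        (ih hA' hB')

lemma norm_exp_mul_I_sub_le {x : ℝ} (hx : |x| ≤ 1) :
    ‖exp (x * I) - (1 + x * I - x ^ 2 / 2)‖ ≤ 2 / 9 * |x| ^ 3 := by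
  have hn : ‖(x * I : ℂ)‖ = |x| := by simp
  have h := exp_bound (x := x * I) (hn ▸ hx) (n := 3) (by norm_num)
  rw [hn] at h
  have h1 : ∑ m ∈ range 3, (x * I : ℂ) ^ m / (m.factorial : ℂ) = 1 + x * I - x ^ 2 / 2 := by
    simp [sum_range_succ, Nat.factorial, mul_pow, I_sq]
    ring
  rw [h1] at h
  refine h.trans (le_of_eq ?_)
  norm_num [Nat.factorial]
  ring

/-- The characteristic function at `θ` of a centred Bernoulli variable with parameter `p`. -/
noncomputable def bernoulliCharFun (θ p : ℝ) : ℂ :=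
  (1 - p) * exp ((-(θ * p) : ℝ) * I) + p * exp ((θ * (1 - p) : ℝ) * I)

lemma norm_bernoulliCharFun_le (θ : ℝ) {p : ℝ} (hp0 : 0 ≤ p) (hp1 : p ≤ 1) :
    ‖bernoulliCharFun θ p‖ ≤ 1 := by
  have h1 : ‖(1 - p : ℂ)‖ = 1 - p := by
    rw [← ofReal_one, ← ofReal_sub, norm_real, Real.norm_of_nonneg (by linarith)]
  have h2 : ‖(p : ℂ)‖ = p := by rw [norm_real, Real.norm_of_nonneg hp0]
  refine (norm_add_le _ _).trans (le_of_eq ?_)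
  rw [norm_mul, norm_mul, norm_exp_ofReal_mul_I, norm_exp_ofReal_mul_I, h1, h2]
  ring

lemma norm_bernoulliCharFun_sub_le {θ p : ℝ} (hθ : |θ| ≤ 1) (hp0 : 0 ≤ p) (hp1 : p ≤ 1) :
    ‖bernoulliCharFun θ p - exp (-(θ ^ 2 * (p * (1 - p)) / 2 : ℝ))‖ ≤
      |θ| ^ 3 * (p * (1 - p)) := by
  have hq0 : 0 ≤ 1 - p := sub_nonneg.2 hp1
  have hpq : 0 ≤ p * (1 - p) := mul_nonneg hp0 hq0
  have hpq1 : p * (1 - p) ≤ 1 := by nlinarith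
  have hθ2 : θ ^ 2 ≤ 1 := by rw [← sq_abs]; exact pow_le_one₀ (abs_nonneg _) hθ
  have n1 : ‖(1 - p : ℂ)‖ = 1 - p := by
    rw [← ofReal_one, ← ofReal_sub, norm_real, Real.norm_of_nonneg hq0]
  have n2 : ‖(p : ℂ)‖ = p := by rw [norm_real, Real.norm_of_nonneg hp0]
  have a1 : |(-(θ * p))| = |θ| * p := by rw [abs_neg, abs_mul, abs_of_nonneg hp0]
  have a2 : |θ * (1 - p)| = |θ| * (1 - p) := by rw [abs_mul, abs_of_nonneg hq0]
  have e1 := norm_exp_mul_I_sub_le (x := -(θ * p))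
    (a1 ▸ mul_le_one₀ hθ hp0 hp1)
  have e2 := norm_exp_mul_I_sub_le (x := θ * (1 - p))
    (a2 ▸ mul_le_one₀ hθ hq0 (by linarith))
  rw [a1] at e1
  rw [a2] at e2
  set R₁ := exp ((-(θ * p) : ℝ) * I) - (1 + (-(θ * p) : ℝ) * I - ((-(θ * p) : ℝ) : ℂ) ^ 2 / 2)
    with hR₁
  set R₂ := exp ((θ * (1 - p) : ℝ) * I) -
    (1 + (θ * (1 - p) : ℝ) * I - ((θ * (1 - p) : ℝ) : ℂ) ^ 2 / 2) with hR₂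
  set w : ℝ := θ ^ 2 * (p * (1 - p)) / 2 with hw
  have hw0 : 0 ≤ w := by positivity
  have hw1 : w ≤ 1 := by nlinarith
  have nw : ‖((-w : ℝ) : ℂ)‖ = w := by rw [norm_real, norm_neg, Real.norm_of_nonneg hw0]
  have e3 := norm_exp_sub_one_sub_id_le (x := ((-w : ℝ) : ℂ)) (nw.trans_le hw1)
  rw [nw] at e3
  have hdecomp : bernoulliCharFun θ p - exp ((-w : ℝ)) =
      (1 - p) * R₁ + p * R₂ - (exp ((-w : ℝ)) - 1 - (-w : ℝ)) := by
    rw [bernoulliCharFun, hR₁, hR₂, hw]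
    push_cast
    ring
  rw [← ofReal_neg, hdecomp]
  have b1 : ‖(1 - p : ℂ) * R₁‖ ≤ (1 - p) * (2 / 9 * (|θ| * p) ^ 3) := by
    rw [norm_mul, n1]
    exact mul_le_mul_of_nonneg_left e1 hq0
  have b2 : ‖(p : ℂ) * R₂‖ ≤ p * (2 / 9 * (|θ| * (1 - p)) ^ 3) := by
    rw [norm_mul, n2]
    exact mul_le_mul_of_nonneg_left e2 hp0
  have b3 : w ^ 2 ≤ |θ| ^ 3 * (p * (1 - p)) / 4 := by
    have h4 : |θ| ^ 4 ≤ |θ| ^ 3 := pow_le_pow_of_le_one (abs_nonneg _) hθ (by norm_num)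
    have h5 : w ^ 2 = |θ| ^ 4 * (p * (1 - p)) * (p * (1 - p)) / 4 := by
      rw [hw, ← sq_abs θ]
      ring
    rw [h5]
    have h6 : |θ| ^ 4 * (p * (1 - p)) ≤ |θ| ^ 3 * (p * (1 - p)) :=
      mul_le_mul_of_nonneg_right h4 hpq
    have h7 : |θ| ^ 4 * (p * (1 - p)) * (p * (1 - p)) ≤ |θ| ^ 4 * (p * (1 - p)) :=
      mul_le_of_le_one_right (by positivity) hpq1
    linarith
  have b4 : (1 - p) * (2 / 9 * (|θ| * p) ^ 3) + p * (2 / 9 * (|θ| * (1 - p)) ^ 3) ≤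
      2 / 9 * (|θ| ^ 3 * (p * (1 - p))) := by
    have h8 : (1 - p) * (2 / 9 * (|θ| * p) ^ 3) + p * (2 / 9 * (|θ| * (1 - p)) ^ 3) =
      2 / 9 * (|θ| ^ 3 * (p * (1 - p))) * (1 - 2 * (p * (1 - p))) := by ring
    rw [h8]
    exact mul_le_of_le_one_right (by positivity) (by linarith)
  have h0 : 0 ≤ |θ| ^ 3 * (p * (1 - p)) := by positivity
  calc _ ≤ ‖(1 - p : ℂ) * R₁‖ + ‖(p : ℂ) * R₂‖ + ‖exp ((-w : ℝ)) - 1 - ((-w : ℝ) : ℂ)‖ :=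
        (norm_sub_le _ _).trans (add_le_add_left (norm_add_le _ _) _)
    _ ≤ _ := by linarith

lemma norm_prod_bernoulliCharFun_sub_le {s : Multiset ℝ} (hs : ∀ p ∈ s, 0 ≤ p ∧ p ≤ 1) {θ : ℝ}
    (hθ : |θ| ≤ 1) :
    ‖(s.map (bernoulliCharFun θ)).prod -
        exp (-(θ ^ 2 * (s.map fun p => p * (1 - p)).sum / 2 : ℝ))‖ ≤
      |θ| ^ 3 * (s.map fun p => p * (1 - p)).sum := by
  have h1 : exp (-(θ ^ 2 * (s.map fun p => p * (1 - p)).sum / 2 : ℝ)) =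
      (s.map fun p => exp (-(θ ^ 2 * (p * (1 - p)) / 2 : ℝ))).prod := by
    clear hs
    induction s using Multiset.induction_on with
    | empty => simp
    | cons p s ih =>
      rw [Multiset.map_cons, Multiset.sum_cons, Multiset.map_cons, Multiset.prod_cons, ← ih,
        ← exp_add]
      congr 1
      push_cast
      ring
  rw [h1]
  refine (norm_multiset_prod_sub_prod_le
    (fun p hp => norm_bernoulliCharFun_le θ (hs p hp).1 (hs p hp).2) fun p hp => ?_).trans ?_
  · rw [← ofReal_neg, norm_exp_ofReal, Real.exp_le_one_iff]
    have := mul_nonneg (hs p hp).1 (sub_nonneg.2 (hs p hp).2)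
    have := mul_nonneg (sq_nonneg θ) this
    linarith
  · rw [← Multiset.sum_map_mul_left]
    exact Multiset.sum_map_le_sum_map _ _ fun p hp =>
      norm_bernoulliCharFun_sub_le hθ (hs p hp).1 (hs p hp).2

variable {V : Type*} [Fintype V] (G : SimpleGraph V)

lemma norm_expected_exp_sub_le {θ : ℝ} (hθ : |θ| ≤ 1) :
    ‖(#(matchings G) : ℂ)⁻¹ * ∑ M ∈ matchings G, exp ((θ * (#M - matchMean G) : ℝ) * I) -
        exp (-(θ ^ 2 * matchVar G / 2 : ℝ))‖ ≤ |θ| ^ 3 * matchVar G := by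
  obtain ⟨s, hs, hG⟩ := exists_matchPoly_eq_prod G
  have hT : (#(matchings G) : ℂ) ≠ 0 := by exact_mod_cast (card_matchings_pos G).ne'
  have h1 := congrArg (Polynomial.aeval (exp (θ * I))) hG
  rw [matchPoly_aeval, map_mul, map_multiset_prod, Multiset.map_map] at h1
  have h2 : (#(matchings G) : ℂ)⁻¹ * ∑ M ∈ matchings G, exp ((θ * (#M - matchMean G) : ℝ) * I) =
      (s.map (bernoulliCharFun θ)).prod := by
    have h3 : ∀ M : Finset (Sym2 V), exp ((θ * (#M - matchMean G) : ℝ) * I) =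
        exp (θ * I) ^ #M * exp (-(θ * s.sum : ℝ) * I) := by
      intro M
      rw [← exp_nat_mul, ← exp_add, matchMean_eq_sum hG]
      congr 1
      push_cast
      ring
    have h4 : exp (-(θ * s.sum : ℝ) * I) = (s.map fun p : ℝ => exp (-(θ * p : ℝ) * I)).prod := by
      clear hs hG h1 h3
      induction s using Multiset.induction_on with
      | empty => simp
      | cons p s ih =>
        rw [Multiset.sum_cons, Multiset.map_cons, Multiset.prod_cons, ← ih, ← exp_add]
        congr 1
        push_cast
        ring
    simp only [h3]
    rw [← sum_mul, h1, h4, mul_assoc, ← Multiset.prod_map_mul]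
    simp only [Polynomial.aeval_C, coe_algebraMap, ofReal_natCast]
    rw [inv_mul_cancel_left₀ hT]
    refine congrArg _ (Multiset.map_congr rfl fun p _ => ?_)
    have h5 : exp ((θ * (1 - p) : ℝ) * I) = exp (θ * I) * exp (-(θ * p : ℝ) * I) := by
      rw [← exp_add]
      congr 1
      push_cast
      ring
    rw [bernoulliCharFun, h5]
    simp
    ring
  rw [h2, matchVar_eq_sum hG]
  exact norm_prod_bernoulliCharFun_sub_le hs hθ

end CentralLimit

section MatchLaw

open scoped Classical
open Finset MeasureTheory ProbabilityTheory

variable {V : Type*} [Fintype V] (G : SimpleGraph V)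

/-- The law of the standardized size of a uniformly random matching. -/
noncomputable def matchLaw : Measure ℝ :=
  (#(matchings G) : ENNReal)⁻¹ •
    ∑ M ∈ matchings G, Measure.dirac ((#M - matchMean G) / √(matchVar G))

instance : IsProbabilityMeasure (matchLaw G) := by
  refine ⟨?_⟩
  have h : (#(matchings G) : ENNReal) ≠ 0 := by
    exact_mod_cast (Nat.cast_pos.1 (card_matchings_pos G)).ne'
  simp [matchLaw, ENNReal.inv_mul_cancel h]

lemma charFun_matchLaw (t : ℝ) : charFun (matchLaw G) t = (#(matchings G) : ℂ)⁻¹ *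
    ∑ M ∈ matchings G,
      Complex.exp ((t / √(matchVar G) * (#M - matchMean G) : ℝ) * Complex.I) := by
  rw [charFun_apply_real, matchLaw, integral_smul_measure,
    integral_finsetSum_measure fun M _ => integrable_dirac (by simp)]
  simp only [integral_dirac, ENNReal.toReal_inv, ENNReal.toReal_natCast, Complex.real_smul,
    Complex.ofReal_inv, Complex.ofReal_natCast]
  refine congrArg _ (sum_congr rfl fun M _ => ?_)
  congr 2
  push_cast
  ring

lemma matchLaw_real_Iic (x : ℝ) : (matchLaw G).real (Set.Iic x) =
    (#(matchings G) : ℝ)⁻¹ *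
      ∑ M ∈ matchings G, if (#M - matchMean G) / √(matchVar G) ≤ x then 1 else 0 := by
  simp only [matchLaw, measureReal_def, Measure.smul_apply, Measure.coe_finsetSum,
    Finset.sum_apply, measurableSet_Iic, Measure.dirac_apply', smul_eq_mul, ENNReal.toReal_mul,
    ENNReal.toReal_inv, ENNReal.toReal_natCast]
  congr 1
  rw [ENNReal.toReal_sum]
  · refine sum_congr rfl fun M _ => ?_
    by_cases h : (#M - matchMean G) / √(matchVar G) ≤ x <;> simp [h]
  · intro M _
    by_cases h : (#M - matchMean G) / √(matchVar G) ≤ x <;> simp [h]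

lemma tendsto_charFun_matchLaw {V : ℕ → Type*} [∀ n, Fintype (V n)] {G : ∀ n, SimpleGraph (V n)}
    (h : Filter.Tendsto (fun n => matchVar (G n)) Filter.atTop Filter.atTop) (t : ℝ) :
    Filter.Tendsto (fun n => charFun (matchLaw (G n)) t) Filter.atTop
      (nhds (charFun (gaussianReal 0 1) t)) := by
  have hσ : Filter.Tendsto (fun n => √(matchVar (G n))) Filter.atTop Filter.atTop :=
    Real.tendsto_sqrt_atTop.comp h
  rw [tendsto_iff_norm_sub_tendsto_zero]
  refine squeeze_zero' (.of_forall fun n => norm_nonneg _) ?_ (hσ.const_div_atTop (|t| ^ 3))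
  filter_upwards [hσ.eventually_gt_atTop 0, hσ.eventually_ge_atTop |t|] with n h0 h1
  have h2 : matchVar (G n) = √(matchVar (G n)) ^ 2 :=
    (Real.sq_sqrt (Real.sqrt_pos.1 h0).le).symm
  have h3 : |t / √(matchVar (G n))| = |t| / √(matchVar (G n)) := by
    rw [abs_div, abs_of_pos h0]
  have key := norm_expected_exp_sub_le (G n) (θ := t / √(matchVar (G n)))
    (by rw [h3]; exact div_le_one_of_le₀ h1 h0.le)
  rw [← charFun_matchLaw, h3] at key
  have h4 : (t / √(matchVar (G n))) ^ 2 * matchVar (G n) / 2 = t ^ 2 / 2 := by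
    conv_lhs => rw [div_pow, ← h2]
    have := Real.sqrt_pos.1 h0
    field_simp
  have h5 : (|t| / √(matchVar (G n))) ^ 3 * matchVar (G n) = |t| ^ 3 / √(matchVar (G n)) := by
    have h6 : √(matchVar (G n)) ^ 3 = √(matchVar (G n)) * matchVar (G n) := by
      conv_rhs => rw [h2, Real.sqrt_sq h0.le]
      ring
    rw [div_pow, h6]
    have := Real.sqrt_pos.1 h0
    field_simp
  rw [h4, h5] at key
  have h6 : charFun (gaussianReal 0 1) t = Complex.exp (-(t ^ 2 / 2 : ℝ)) := by
    rw [charFun_gaussianReal]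
    congr 1
    simp
  rwa [h6]

lemma stdNormalCDF_eq (x : ℝ) : stdNormalCDF x = (gaussianReal 0 1).real (Set.Iic x) := by
  rw [measureReal_def, gaussianReal_apply_eq_integral _ one_ne_zero, ENNReal.toReal_ofReal
    (integral_nonneg fun _ => gaussianPDFReal_nonneg _ _ _), integral_Iic_eq_integral_Iio,
    stdNormalCDF]
  refine integral_congr_ae (.of_forall fun t => ?_)
  simp [gaussianPDFReal, div_eq_inv_mul]

lemma tendsto_matchLaw_real_Iic {V : ℕ → Type*} [∀ n, Fintype (V n)]
    {G : ∀ n, SimpleGraph (V n)}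
    (h : Filter.Tendsto (fun n => matchVar (G n)) Filter.atTop Filter.atTop) (x : ℝ) :
    Filter.Tendsto (fun n => (matchLaw (G n)).real (Set.Iic x)) Filter.atTop
      (nhds (stdNormalCDF x)) := by
  have h1 := ProbabilityMeasure.tendsto_of_tendsto_charFun
    (μ := fun n => ⟨matchLaw (G n), inferInstance⟩)
    (μ₀ := ⟨gaussianReal 0 1, inferInstance⟩) (tendsto_charFun_matchLaw h)
  have := nullSingletonClass_gaussianReal (μ := 0) one_ne_zero
  have h2 := ProbabilityMeasure.tendsto_measure_of_null_frontier_of_tendsto' h1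
    (E := Set.Iic x) (by simp)
  rw [stdNormalCDF_eq]
  exact (ENNReal.tendsto_toReal (measure_ne_top _ _)).comp h2

end MatchLaw

section MatchSequence

open scoped Classical
open Finset

variable {V : Type*} [Fintype V] (G : SimpleGraph V)

/-- The matching sequence of `G`, indexed by `ℤ`. -/
noncomputable def matchSeq (k : ℤ) : ℝ := if 0 ≤ k then (matchCount G k.toNat : ℝ) else 0

lemma matchSeq_eq_card (k : ℤ) : matchSeq G k = #{M ∈ matchings G | (#M : ℤ) = k} := by
  rw [matchSeq]
  split_ifs with h
  · lift k to ℕ using h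
    simp [matchCount_eq_card]
  · rw [filter_false_of_mem fun M _ => by omega]
    simp

lemma finsum_mul_matchSeq (F : ℤ → ℝ) :
    ∑ᶠ k, F k * matchSeq G k = ∑ M ∈ matchings G, F #M := by
  rw [finsum_eq_sum_of_support_subset (s := (matchings G).image fun M => (#M : ℤ)),
    sum_comp F fun M : Finset (Sym2 V) => (#M : ℤ)]
  · exact sum_congr rfl fun k _ => by rw [matchSeq_eq_card, nsmul_eq_mul, mul_comm]
  · intro k hk
    have h := right_ne_zero_of_mul hk
    rw [matchSeq_eq_card, Nat.cast_ne_zero, card_ne_zero] at h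
    obtain ⟨M, hM⟩ := h
    exact mem_coe.2 (mem_image.2 ⟨M, mem_filter.1 hM⟩)

lemma finsum_mul_seqPMF_matchSeq (F : ℤ → ℝ) : ∑ᶠ k, F k * seqPMF (matchSeq G) k =
    (#(matchings G) : ℝ)⁻¹ * ∑ M ∈ matchings G, F #M := by
  have h : seqTotal (matchSeq G) = #(matchings G) := by
    simpa [seqTotal] using finsum_mul_matchSeq G fun _ => 1
  rw [mul_sum, ← finsum_mul_matchSeq G fun k => (#(matchings G) : ℝ)⁻¹ * F k]
  refine finsum_congr fun k => ?_
  rw [seqPMF, h]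
  ring

lemma seqMean_matchSeq : seqMean (matchSeq G) = matchMean G := by
  rw [seqMean, finsum_mul_seqPMF_matchSeq G fun k => (k : ℝ)]
  simp only [Int.cast_natCast]
  rw [sum_card_matchings, inv_mul_cancel_left₀ (card_matchings_pos G).ne']

lemma seqStdDev_matchSeq : seqStdDev (matchSeq G) = √(matchVar G) := by
  rw [seqStdDev, finsum_mul_seqPMF_matchSeq G fun k => ((k : ℝ) - seqMean (matchSeq G)) ^ 2,
    seqMean_matchSeq]
  simp only [Int.cast_natCast]
  rw [sum_sub_sq_matchings, inv_mul_cancel_left₀ (card_matchings_pos G).ne']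

lemma seqNormalizedCDF_matchSeq (x : ℝ) :
    seqNormalizedCDF (matchSeq G) x = (matchLaw G).real (Set.Iic x) := by
  rw [matchLaw_real_Iic, seqNormalizedCDF, finsum_mem_def, seqMean_matchSeq, seqStdDev_matchSeq]
  have h := finsum_mul_seqPMF_matchSeq G
    fun k => if ((k : ℝ) - matchMean G) / √(matchVar G) ≤ x then 1 else 0
  simp only [Int.cast_natCast] at h
  rw [← h]
  refine finsum_congr fun k => ?_
  by_cases hk : ((k : ℝ) - matchMean G) / √(matchVar G) ≤ x <;> simp [Set.indicator, hk]

end MatchSequence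

/-- Kahn's theorem: if each `G n` has minimum degree at least one, the number of vertices
`v n` tends to infinity and the matching number satisfies `ν n ∼ v n / 2`, then the matching
sequence of `G n` is asymptotically normal. -/
theorem kahn_matchings_asymptotically_normal
    (V : ℕ → Type) [∀ n, Fintype (V n)] (G : ∀ n, SimpleGraph (V n))
    (hmin : ∀ n, ∀ v : V n, ∃ u : V n, (G n).Adj v u)
    (v : ℕ → ℕ) (hv : ∀ n, v n = Fintype.card (V n))
    (ν : ℕ → ℕ) (hν : ∀ n, ν n = matchNumber (G n))
    (hvtop : Filter.Tendsto v Filter.atTop Filter.atTop)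
    (hasymp : Filter.Tendsto (fun n => (ν n : ℝ) / ((v n : ℝ) / 2))
      Filter.atTop (nhds 1)) :
    AsymptoticallyNormal (fun n k => if 0 ≤ k then (matchCount (G n) k.toNat : ℝ) else 0) := by
  exact fun x => (tendsto_matchLaw_real_Iic (tendsto_matchVar hv hν hvtop hasymp) x).congr
    fun n => (seqNormalizedCDF_matchSeq (G n) x).symm
end

section
/- (Heilmann–Lieb) For any finite simple graph G, the matching polynomial Σ_{k ∈ ℤ} m_k(G) x^k, where m_k(G) is the number of matchings of size k in G, has only real zeros. -/
/-- `matchingsWithin G S` is the set of matchings of `G` all of whose edges lie inside `S`. -/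
noncomputable def matchingsWithin {V : Type*} [Fintype V] (G : SimpleGraph V) (S : Finset V) :
    Finset (Finset (Sym2 V)) := by
  classical
  exact Finset.univ.filter fun s => (∀ e ∈ s, e ∈ G.edgeSet) ∧
    (∀ e ∈ s, ∀ f ∈ s, e ≠ f → ∀ v : V, v ∈ e → v ∉ f) ∧ ∀ e ∈ s, ∀ v ∈ e, v ∈ S

theorem mem_matchingsWithin {V : Type*} [Fintype V] {G : SimpleGraph V} {S : Finset V}
    {s : Finset (Sym2 V)} : s ∈ matchingsWithin G S ↔ (∀ e ∈ s, e ∈ G.edgeSet) ∧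
      (∀ e ∈ s, ∀ f ∈ s, e ≠ f → ∀ v : V, v ∈ e → v ∉ f) ∧ ∀ e ∈ s, ∀ v ∈ e, v ∈ S := by
  simp [matchingsWithin]

/-- The matching generating function of the subgraph of `G` induced on `S`, evaluated at `z`. -/
noncomputable def matchingSum {V : Type*} [Fintype V] (G : SimpleGraph V) (z : ℂ)
    (S : Finset V) : ℂ :=
  ∑ s ∈ matchingsWithin G S, z ^ s.card

theorem matchingSum_empty {V : Type*} [Fintype V] (G : SimpleGraph V) (z : ℂ) :
    matchingSum G z ∅ = 1 := by
  have h : matchingsWithin G ∅ = {∅} := by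
    ext s
    rw [mem_matchingsWithin, Finset.mem_singleton]
    constructor
    · rintro ⟨-, -, h⟩
      refine Finset.eq_empty_of_forall_notMem fun e he => ?_
      exact absurd (h e he _ e.out_fst_mem) (Finset.notMem_empty _)
    · rintro rfl
      simp
  simp [matchingSum, h]

open Classical in
/-- Adding the edge `vu` to the matchings inside `S \ {u}` gives the matchings inside `S ∪ {v}`
that cover `v`. -/
theorem sum_matchingsWithin_covering {V : Type*} [Fintype V] (G : SimpleGraph V) (z : ℂ)
    {S : Finset V} {v : V} (hv : v ∉ S) :
    ∑ s ∈ (matchingsWithin G (insert v S)).filter (fun s => ∃ e ∈ s, v ∈ e), z ^ s.card =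
      ∑ u ∈ S.filter (G.Adj v), z * matchingSum G z (S.erase u) := by
  simp only [matchingSum, Finset.mul_sum]
  rw [Finset.sum_sigma']
  symm
  have fresh : ∀ u, ∀ t ∈ matchingsWithin G (S.erase u), ∀ e ∈ t, v ∉ e ∧ u ∉ e := by
    intro u t ht e he
    have h := (mem_matchingsWithin.1 ht).2.2 e he
    exact ⟨fun hve => hv (Finset.mem_of_mem_erase (h v hve)),
      fun hue => Finset.notMem_erase u S (h u hue)⟩
  have notMem : ∀ u, ∀ t ∈ matchingsWithin G (S.erase u), ∀ u', s(v, u') ∉ t :=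
    fun u t ht u' h => (fresh u t ht _ h).1 (Sym2.mem_mk_left v u')
  refine Finset.sum_bij (fun p _ => insert s(v, p.1) p.2) ?_ ?_ ?_ ?_
  · rintro ⟨u, t⟩ hp
    simp only [Finset.mem_sigma, Finset.mem_filter] at hp
    obtain ⟨⟨hu, hadj⟩, ht⟩ := hp
    have hf := fresh u t ht
    obtain ⟨h1, h2, h3⟩ := mem_matchingsWithin.1 ht
    simp only [Finset.mem_filter, mem_matchingsWithin]
    refine ⟨⟨?_, ?_, ?_⟩, s(v, u), Finset.mem_insert_self _ _, Sym2.mem_mk_left v u⟩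
    · intro e he
      rcases Finset.mem_insert.1 he with rfl | he
      · exact hadj
      · exact h1 e he
    · intro e he f hf' hne x hxe hxf
      rcases Finset.mem_insert.1 he with rfl | het <;>
        rcases Finset.mem_insert.1 hf' with rfl | hft
      · exact hne rfl
      · rcases Sym2.mem_iff.1 hxe with rfl | rfl
        · exact (hf f hft).1 hxf
        · exact (hf f hft).2 hxf
      · rcases Sym2.mem_iff.1 hxf with rfl | rfl
        · exact (hf e het).1 hxe
        · exact (hf e het).2 hxe
      · exact h2 e het f hft hne x hxe hxf
    · intro e he x hx
      rcases Finset.mem_insert.1 he with rfl | he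
      · rcases Sym2.mem_iff.1 hx with rfl | rfl
        · exact Finset.mem_insert_self _ _
        · exact Finset.mem_insert_of_mem hu
      · exact Finset.mem_insert_of_mem (Finset.mem_of_mem_erase (h3 e he x hx))
  · rintro ⟨u, t⟩ hp ⟨u', t'⟩ hp' heq
    simp only [Finset.mem_sigma] at hp hp' heq
    have hmem : s(v, u) ∈ insert s(v, u') t' := heq ▸ Finset.mem_insert_self _ _
    have huu : u = u' := by
      rcases Finset.mem_insert.1 hmem with h | h
      · exact Sym2.congr_right.1 h
      · exact absurd h (notMem _ _ hp'.2 _)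
    subst huu
    have : t = t' := by
      rw [← Finset.erase_insert (notMem _ _ hp.2 u), heq,
        Finset.erase_insert (notMem _ _ hp'.2 u)]
    rw [this]
  · intro s hs
    simp only [Finset.mem_filter] at hs
    obtain ⟨hs, e, he, hve⟩ := hs
    obtain ⟨h1, h2, h3⟩ := mem_matchingsWithin.1 hs
    obtain ⟨u, rfl⟩ := hve
    have hadj : G.Adj v u := h1 _ he
    have hu : u ∈ S := Finset.mem_of_mem_insert_of_ne (h3 _ he u (Sym2.mem_mk_right v u))
      hadj.ne'
    refine ⟨⟨u, s.erase s(v, u)⟩, ?_, Finset.insert_erase he⟩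
    simp only [Finset.mem_sigma, Finset.mem_filter, mem_matchingsWithin]
    refine ⟨⟨hu, hadj⟩, fun f hf => h1 f (Finset.mem_of_mem_erase hf),
      fun f hf g hg => h2 f (Finset.mem_of_mem_erase hf) g (Finset.mem_of_mem_erase hg), ?_⟩
    intro f hf x hx
    obtain ⟨hne, hf⟩ := Finset.mem_erase.1 hf
    have hd := h2 f hf _ he hne x hx
    refine Finset.mem_erase.2 ⟨?_, Finset.mem_of_mem_insert_of_ne (h3 f hf x hx) ?_⟩
    · rintro rfl
      exact hd (Sym2.mem_mk_right v x)
    · rintro rfl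
      exact hd (Sym2.mem_mk_left x u)
  · rintro ⟨u, t⟩ hp
    simp only [Finset.mem_sigma] at hp
    rw [Finset.card_insert_of_notMem (notMem _ _ hp.2 u), pow_succ']

open Classical in
theorem matchingSum_insert {V : Type*} [Fintype V] (G : SimpleGraph V) (z : ℂ)
    {S : Finset V} {v : V} (hv : v ∉ S) :
    matchingSum G z (insert v S) =
      matchingSum G z S + ∑ u ∈ S.filter (G.Adj v), z * matchingSum G z (S.erase u) := by
  rw [← sum_matchingsWithin_covering G z hv, matchingSum,
    ← Finset.sum_filter_not_add_sum_filter _ (fun s => ∃ e ∈ s, v ∈ e)]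
  congr 1
  refine Finset.sum_congr ?_ fun _ _ => rfl
  ext s
  simp only [Finset.mem_filter, mem_matchingsWithin, not_exists, not_and]
  constructor
  · rintro ⟨⟨h1, h2, h3⟩, h⟩
    exact ⟨h1, h2, fun e he x hx => Finset.mem_of_mem_insert_of_ne (h3 e he x hx)
      fun hxv => h e he (hxv ▸ hx)⟩
  · rintro ⟨h1, h2, h3⟩
    exact ⟨⟨h1, h2, fun e he x hx => Finset.mem_insert_of_mem (h3 e he x hx)⟩,
      fun e he hve => hv (h3 e he v hve)⟩

theorem Complex.inv_im_neg {z : ℂ} (hz : 0 < z.im) : (z⁻¹).im < 0 := by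
  rw [Complex.inv_im]
  refine div_neg_of_neg_of_pos (neg_lt_zero.2 hz) (Complex.normSq_pos.2 ?_)
  rintro rfl
  simp at hz

open Classical in
/-- If `w ^ 2 * z = -1` with `w` in the upper half-plane, then the matching generating function
at `z` does not vanish, and deleting a vertex changes it by a ratio that `w` takes to the upper
half-plane. -/
theorem matchingSum_ne_zero_and_im_pos {V : Type*} [Fintype V] (G : SimpleGraph V) {z w : ℂ}
    (hw : 0 < w.im) (hwz : w ^ 2 * z = -1) (S : Finset V) :
    matchingSum G z S ≠ 0 ∧
      ∀ v ∉ S, 0 < (w * (matchingSum G z (insert v S) / matchingSum G z S)).im := by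
  have hw0 : w ≠ 0 := by
    rintro rfl
    simp at hw
  induction S using Finset.strongInduction with
  | H S ih =>
    have hS : matchingSum G z S ≠ 0 := by
      rcases S.eq_empty_or_nonempty with rfl | ⟨u, hu⟩
      · simp [matchingSum_empty]
      · have h := (ih _ (Finset.erase_ssubset hu)).2 u (Finset.notMem_erase u S)
        rw [Finset.insert_erase hu] at h
        intro h0
        simp [h0] at h
    refine ⟨hS, fun v hv => ?_⟩
    have key : w * (matchingSum G z (insert v S) / matchingSum G z S) =
        w - ∑ u ∈ S.filter (G.Adj v),
          (w * (matchingSum G z S / matchingSum G z (S.erase u)))⁻¹ := by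
      rw [matchingSum_insert G z hv, add_div, div_self hS, mul_add, mul_one, sub_eq_add_neg,
        Finset.sum_div, Finset.mul_sum, ← Finset.sum_neg_distrib]
      congr 1
      refine Finset.sum_congr rfl fun u _ => ?_
      rw [mul_inv, inv_div, mul_div_assoc, ← mul_assoc, ← neg_mul]
      congr 1
      field_simp
      linear_combination hwz
    rw [key, Complex.sub_im, Complex.im_sum]
    refine lt_of_lt_of_le hw ?_
    rw [le_sub_self_iff]
    refine Finset.sum_nonpos fun u hu => (Complex.inv_im_neg ?_).le
    have hu := (Finset.mem_filter.1 hu).1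
    have h := (ih _ (Finset.erase_ssubset hu)).2 u (Finset.notMem_erase u S)
    rwa [Finset.insert_erase hu] at h

theorem exists_im_pos_sq_mul_eq_neg_one {z : ℂ} (hz : z.im ≠ 0) :
    ∃ w : ℂ, 0 < w.im ∧ w ^ 2 * z = -1 := by
  have hz0 : z ≠ 0 := by
    rintro rfl
    simp at hz
  obtain ⟨w, hw⟩ := IsAlgClosed.exists_pow_nat_eq (-z⁻¹) (n := 2) two_pos
  have hwz : w ^ 2 * z = -1 := by
    rw [hw]
    field_simp
  have him : w.im ≠ 0 := by
    intro h
    have hreal : w = (w.re : ℂ) := Complex.ext rfl (by simpa using h)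
    rw [hreal, ← Complex.ofReal_pow] at hwz
    have h1 := congrArg Complex.im hwz
    have h2 := congrArg Complex.re hwz
    rw [Complex.im_ofReal_mul] at h1
    rw [Complex.re_ofReal_mul] at h2
    rcases mul_eq_zero.1 (h1.trans (by simp)) with h | h
    · simp [h] at h2
    · exact hz h
  rcases lt_or_gt_of_ne him with h | h
  · exact ⟨-w, by simpa using h, by simpa using hwz⟩
  · exact ⟨w, h, hwz⟩

theorem card_le_of_mem_matchingsWithin {V : Type*} [Fintype V] {G : SimpleGraph V} {S : Finset V}
    {s : Finset (Sym2 V)} (hs : s ∈ matchingsWithin G S) : s.card ≤ S.card := by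
  obtain ⟨-, h2, h3⟩ := mem_matchingsWithin.1 hs
  refine Finset.card_le_card_of_injOn (fun e => e.out.1) (fun e he => h3 e he _ e.out_fst_mem) ?_
  intro e he f hf hef
  by_contra hne
  refine h2 e he f hf hne _ e.out_fst_mem ?_
  have := f.out_fst_mem
  rwa [← show e.out.1 = f.out.1 from hef] at this

theorem matchCount_eq_card_filter {V : Type*} [Fintype V] (G : SimpleGraph V) (k : ℕ) :
    matchCount G k = ((matchingsWithin G Finset.univ).filter (fun s => s.card = k)).card := by
  rw [matchCount, ← Nat.card_eq_finsetCard]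
  refine Nat.card_congr (Equiv.subtypeEquivRight fun s => ?_)
  simp [mem_matchingsWithin, and_comm]

theorem sum_matchCount_mul_pow {V : Type*} [Fintype V] (G : SimpleGraph V) (z : ℂ) :
    ∑ k ∈ Finset.range (Fintype.card V + 1), (matchCount G k : ℂ) * z ^ k =
      matchingSum G z Finset.univ := by
  rw [matchingSum, ← Finset.sum_fiberwise_of_maps_to (g := Finset.card)
    (t := Finset.range (Fintype.card V + 1))
    fun s hs => Finset.mem_range.2 (Nat.lt_succ_of_le (card_le_of_mem_matchingsWithin hs))]
  refine Finset.sum_congr rfl fun k _ => ?_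
  rw [matchCount_eq_card_filter, Finset.sum_congr rfl fun s hs => by
    rw [(Finset.mem_filter.1 hs).2], Finset.sum_const, nsmul_eq_mul]

/-- The Heilmann–Lieb theorem: the matching polynomial `Σ_k m_k(G) x^k` of a finite simple
graph has only real zeros (every complex root is real). -/
theorem heilmann_lieb {V : Type*} [Fintype V] (G : SimpleGraph V) (z : ℂ)
    (hz : Polynomial.aeval z (∑ k ∈ Finset.range (Fintype.card V + 1),
      (matchCount G k : Polynomial ℝ) * Polynomial.X ^ k) = 0) :
    z.im = 0 := by
  by_contra him
  obtain ⟨w, hw, hwz⟩ := exists_im_pos_sq_mul_eq_neg_one him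
  refine (matchingSum_ne_zero_and_im_pos G hw hwz Finset.univ).1 ?_
  rw [← sum_matchCount_mul_pow]
  simpa using hz
end

section
/- Let w be a Dyck word with n x's such that the associated graph G_w equals a given quasi-threshold graph G on n vertices. Then the matching number of the bipartite graph Γ_w (the size of a largest matching in Γ_w) equals n − χ(G), where χ(G) is the chromatic number of G. -/
/-- The graph obtained from `G` by adding a dominating vertex (a new vertex adjacent to all
the vertices of `G`). -/
def addDom {V : Type} (G : SimpleGraph V) : SimpleGraph (Option V) :=
  SimpleGraph.fromRel (fun a b =>
    (∃ u v : V, a = some u ∧ b = some v ∧ G.Adj u v) ∨ a = none)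

/-- The disjoint union of two graphs. -/
def disjUnion {V W : Type} (G : SimpleGraph V) (H : SimpleGraph W) : SimpleGraph (V ⊕ W) :=
  SimpleGraph.fromRel (fun a b =>
    (∃ u v : V, a = Sum.inl u ∧ b = Sum.inl v ∧ G.Adj u v) ∨
    (∃ u v : W, a = Sum.inr u ∧ b = Sum.inr v ∧ H.Adj u v))

/-- Quasi-threshold graphs: the smallest class of graphs (closed under isomorphism) containing
`K_1` and closed under adding a dominating vertex and under disjoint union. -/
inductive IsQuasiThreshold : {V : Type} → SimpleGraph V → Prop where
  | single : IsQuasiThreshold (⊥ : SimpleGraph PUnit)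
  | addDominating {V : Type} {G : SimpleGraph V} :
      IsQuasiThreshold G → IsQuasiThreshold (addDom G)
  | union {V W : Type} {G : SimpleGraph V} {H : SimpleGraph W} :
      IsQuasiThreshold G → IsQuasiThreshold H → IsQuasiThreshold (disjUnion G H)
  | iso {V W : Type} {G : SimpleGraph V} {H : SimpleGraph W} :
      IsQuasiThreshold G → G ≃g H → IsQuasiThreshold H
/-- `WordGraph w V G` asserts that `G` (on vertex set `V`) is the quasi-threshold graph `G_w`
associated with the Dyck word `w`: `G_{xD} = K_1`; `G_{x w' D} = G_{w'}` plus a dominating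
vertex; and the graph of a concatenation of non-empty Dyck words is the disjoint union of
their graphs. -/
inductive WordGraph : List Bool → (V : Type) → SimpleGraph V → Prop where
  | k1 : WordGraph [true, false] PUnit ⊥
  | dom {w : List Bool} {V : Type} {G : SimpleGraph V} :
      WordGraph w V G → WordGraph ([true] ++ w ++ [false]) (Option V) (addDom G)
  | union {w₁ w₂ : List Bool} {V₁ V₂ : Type} {G₁ : SimpleGraph V₁} {G₂ : SimpleGraph V₂} :
      w₁ ≠ [] → w₂ ≠ [] → WordGraph w₁ V₁ G₁ → WordGraph w₂ V₂ G₂ →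
      WordGraph (w₁ ++ w₂) (V₁ ⊕ V₂) (disjUnion G₁ G₂)
/-- `xsBefore w i` is the number of `x`'s (`true`s) occurring before the `i`-th `D` (`false`)
in the word `w` (1-indexed); if `w` has fewer than `i` `D`'s it is the total number of `x`'s. -/
def xsBefore : List Bool → ℕ → ℕ
  | [], _ => 0
  | _ :: _, 0 => 0
  | true :: w, i + 1 => xsBefore w (i + 1) + 1
  | false :: w, i + 1 => if i = 0 then 0 else xsBefore w i

/-- The Ferrers board `B_w`: the set of (labels of) unit squares lying above the Dyck path of
`w` and inside the box `[0,n] × [0,n]`, where the unit square with top-right corner `(i,j)` is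
labelled `(i,j)`.  The square `(i,j)` lies above the path exactly when the `i`-th `D` of `w`
occurs before the `j`-th `x`, i.e. when `xsBefore w i < j`. -/
def ferrersBoard (w : List Bool) : Finset (ℕ × ℕ) :=
  ((Finset.Icc 1 (w.count true)) ×ˢ (Finset.Icc 1 (w.count true))).filter
    (fun p => xsBefore w p.1 < p.2)

/-- `rookCount B k` is the number of placements of `k` non-attacking rooks on the board `B`:
`k`-element subsets of `B` with no two elements sharing a first coordinate and no two sharing
a second coordinate. -/
noncomputable def rookCount (B : Finset (ℕ × ℕ)) (k : ℕ) : ℕ :=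
  Nat.card {s : Finset (ℕ × ℕ) // s ⊆ B ∧ s.card = k ∧
    ∀ p ∈ s, ∀ q ∈ s, p ≠ q → p.1 ≠ q.1 ∧ p.2 ≠ q.2}

/-- The clique-union graph `H_w` on vertex set `{1, …, n}` (encoded as `Fin n`, vertex `i`
having label `i+1`): labels `i < j` are adjacent iff the unit square labelled `(i,j)` lies
below the Dyck path of `w` and completely above the line `x = y`, i.e. iff the `j`-th `x`
occurs before the `i`-th `D`, i.e. iff `j ≤ xsBefore w i`. -/
def cliqueUnionGraph (w : List Bool) : SimpleGraph (Fin (w.count true)) :=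
  SimpleGraph.fromRel (fun i j => (i : ℕ) < (j : ℕ) ∧ (j : ℕ) + 1 ≤ xsBefore w ((i : ℕ) + 1))

/-- The bipartite graph `Γ_w` with partition classes `X = {x_1, …, x_n}` (the `inl` vertices)
and `Y = {y_1, …, y_n}` (the `inr` vertices), with an edge from `x_i` to `y_j` iff
`(i,j) ∈ B_w`. -/
def bipGraph (w : List Bool) : SimpleGraph (Fin (w.count true) ⊕ Fin (w.count true)) :=
  SimpleGraph.fromRel (fun a b => ∃ i j : Fin (w.count true),
    a = Sum.inl i ∧ b = Sum.inr j ∧ xsBefore w ((i : ℕ) + 1) < (j : ℕ) + 1)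

/-- A word in the symbols `x` (here `true`) and `D` (here `false`) is a Dyck word if it has
equally many `x`'s and `D`'s and every prefix has at least as many `x`'s as `D`'s. -/
def IsDyck (w : List Bool) : Prop :=
  w.count true = w.count false ∧
    ∀ p : ℕ, (w.take p).count false ≤ (w.take p).count true

theorem addDom_adj_some {V : Type} {G : SimpleGraph V} {u v : V} :
    (addDom G).Adj (some u) (some v) ↔ G.Adj u v := by
  simp only [addDom, SimpleGraph.fromRel_adj]
  constructor
  · rintro ⟨-, (⟨a, b, ha, hb, h⟩ | h) | (⟨a, b, ha, hb, h⟩ | h)⟩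
    · cases ha; cases hb; exact h
    · cases h
    · cases ha; cases hb; exact h.symm
    · cases h
  · intro h
    exact ⟨fun e => h.ne (Option.some.inj e), Or.inl (Or.inl ⟨u, v, rfl, rfl, h⟩)⟩

theorem addDom_adj_none {V : Type} {G : SimpleGraph V} (v : V) :
    (addDom G).Adj none (some v) := by
  simp [addDom, SimpleGraph.fromRel_adj]

theorem disjUnion_eq_sum {V W : Type} (G : SimpleGraph V) (H : SimpleGraph W) :
    disjUnion G H = G ⊕g H := by
  ext a b
  rcases a with a | a <;> rcases b with b | b <;>
    simp [disjUnion, SimpleGraph.fromRel_adj, SimpleGraph.adj_comm]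
  · exact fun h => h.ne
  · exact fun h => h.ne

theorem colorable_addDom {V : Type} {G : SimpleGraph V} {h : ℕ} (hG : G.Colorable h) :
    (addDom G).Colorable (h + 1) := by
  obtain ⟨c⟩ := hG
  have c' : (addDom G).Coloring (Option (Fin h)) :=
    SimpleGraph.Coloring.mk (Option.map c) fun {u v} huv => by
      rcases u with _ | u <;> rcases v with _ | v
      · exact absurd huv ((addDom G).loopless.irrefl _)
      · simp
      · simp
      · simpa using c.valid (addDom_adj_some.1 huv)
  simpa using c'.colorable

theorem nonempty_hom_addDom {V : Type} {G : SimpleGraph V} {h : ℕ}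
    (hG : Nonempty ((⊤ : SimpleGraph (Fin h)) →g G)) :
    Nonempty ((⊤ : SimpleGraph (Fin (h + 1))) →g addDom G) := by
  obtain ⟨f⟩ := hG
  refine ⟨⟨Fin.cases none fun i => some (f i), fun {i j} hij => ?_⟩⟩
  induction i using Fin.cases with
  | zero =>
    induction j using Fin.cases with
    | zero => exact absurd rfl hij
    | succ j => exact addDom_adj_none _
  | succ i =>
    induction j using Fin.cases with
    | zero => exact (addDom_adj_none _).symm
    | succ j =>
      exact addDom_adj_some.2 (f.map_adj fun e => hij (congrArg Fin.succ e))

theorem xsBefore_le_count (w : List Bool) (i : ℕ) : xsBefore w i ≤ w.count true := by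
  induction w generalizing i with
  | nil => simp [xsBefore]
  | cons b w ih =>
    rcases b <;> rcases i with _ | i <;> simp only [xsBefore]
    · simp
    · split_ifs
      · simp
      · simpa using ih i
    · simp
    · simpa using ih (i + 1)

theorem monotone_xsBefore (w : List Bool) : Monotone (xsBefore w) := by
  refine monotone_nat_of_le_succ fun i => ?_
  induction w generalizing i with
  | nil => simp [xsBefore]
  | cons b w ih =>
    rcases b <;> rcases i with _ | i <;> simp only [xsBefore]
    · simp
    · rw [if_neg i.succ_ne_zero]
      rcases i with _ | i
      · simp
      · simpa using ih (i + 1)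
    · simp
    · simpa using ih (i + 1)

theorem xsBefore_append_of_lt {u : List Bool} (v : List Bool) {i : ℕ}
    (hi : i < u.count false) : xsBefore (u ++ v) (i + 1) = xsBefore u (i + 1) := by
  induction u generalizing i with
  | nil => simp at hi
  | cons b u ih =>
    rcases b
    · rcases i with _ | i
      · simp [xsBefore]
      · simpa [xsBefore] using ih (i := i) (by simpa using hi)
    · simpa [xsBefore] using ih (i := i) (by simpa using hi)

theorem xsBefore_append_count_add (u v : List Bool) (i : ℕ) :
    xsBefore (u ++ v) (u.count false + i + 1) = u.count true + xsBefore v (i + 1) := by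
  induction u with
  | nil => simp
  | cons b u ih =>
    rcases b
    · simp only [List.cons_append, List.count_cons_self, xsBefore]
      rw [if_neg (by omega), show u.count false + 1 + i = u.count false + i + 1 by omega, ih]
      simp
    · simp only [List.cons_append, List.count_cons_self, xsBefore]
      rw [List.count_cons_of_ne (by simp), ih]
      omega

/-- `PathHeight w h` asserts that the lattice path of `w` has maximal height `h` above the
diagonal, read off at its right steps. -/
def PathHeight (w : List Bool) (h : ℕ) : Prop :=
  (∀ i < w.count true, xsBefore w (i + 1) ≤ i + h) ∧
    ∃ i < w.count true, xsBefore w (i + 1) = i + h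

theorem WordGraph.count_eq {w : List Bool} {V : Type} {G : SimpleGraph V}
    (hw : WordGraph w V G) : w.count true = w.count false := by
  induction hw with
  | k1 => rfl
  | dom _ ih => simp [ih]
  | union _ _ _ _ ih₁ ih₂ => simp [ih₁, ih₂]

theorem PathHeight.dom {w : List Bool} {h : ℕ} (hc : w.count true = w.count false)
    (hw : PathHeight w h) : PathHeight ([true] ++ w ++ [false]) (h + 1) := by
  have hlt : ∀ i < w.count true,
      xsBefore ([true] ++ w ++ [false]) (i + 1) = xsBefore w (i + 1) + 1 := fun i hi => by
    simp [xsBefore, xsBefore_append_of_lt [false] (hc ▸ hi)]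
  have hcount : ([true] ++ w ++ [false]).count true = w.count true + 1 := by simp
  obtain ⟨hle, i, hi, hieq⟩ := hw
  refine ⟨fun j hj => ?_, i, by omega, by rw [hlt i hi, hieq]; omega⟩
  rcases Nat.lt_or_ge j (w.count true) with hj' | hj'
  · rw [hlt j hj']
    have := hle j hj'
    omega
  · have := xsBefore_le_count ([true] ++ w ++ [false]) (j + 1)
    omega

theorem PathHeight.append {u v : List Bool} {h k : ℕ} (hc : u.count true = u.count false)
    (hu : PathHeight u h) (hv : PathHeight v k) : PathHeight (u ++ v) (max h k) := by
  have hleft : ∀ i < u.count true, xsBefore (u ++ v) (i + 1) = xsBefore u (i + 1) :=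
    fun i hi => xsBefore_append_of_lt v (hc ▸ hi)
  have hright : ∀ i, xsBefore (u ++ v) (u.count true + i + 1) =
      u.count true + xsBefore v (i + 1) := fun i => by
    rw [← xsBefore_append_count_add, hc]
  have hcount : (u ++ v).count true = u.count true + v.count true := List.count_append
  obtain ⟨hule, i, hi, hieq⟩ := hu
  obtain ⟨hvle, j, hj, hjeq⟩ := hv
  refine ⟨fun l hl => ?_, ?_⟩
  · rcases Nat.lt_or_ge l (u.count true) with hl' | hl'
    · rw [hleft l hl']
      have := hule l hl'
      omega
    · obtain ⟨m, rfl⟩ := Nat.exists_eq_add_of_le hl'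
      rw [hright]
      have := hvle m (by omega)
      omega
  · rcases le_total h k with hhk | hhk
    · exact ⟨u.count true + j, by omega, by rw [hright, hjeq]; omega⟩
    · exact ⟨i, by omega, by rw [hleft i hi, hieq]; omega⟩

theorem WordGraph.exists_pathHeight {w : List Bool} {V : Type} {G : SimpleGraph V}
    (hw : WordGraph w V G) : ∃ h, PathHeight w h ∧ G.Colorable h ∧
      Nonempty ((⊤ : SimpleGraph (Fin h)) →g G) := by
  induction hw with
  | k1 =>
    refine ⟨1, ⟨by simp [xsBefore], 0, by simp [xsBefore]⟩,
      ⟨SimpleGraph.Coloring.mk (fun _ => 0) fun h => absurd h (by simp)⟩,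
      ⟨⟨fun _ => PUnit.unit, fun {a b} h => absurd (Subsingleton.elim a b) h⟩⟩⟩
  | dom hw ih =>
    obtain ⟨h, hp, hcol, hcl⟩ := ih
    exact ⟨h + 1, hp.dom hw.count_eq, colorable_addDom hcol, nonempty_hom_addDom hcl⟩
  | @union _ _ V₁ V₂ G₁ G₂ _ _ hw₁ _ ih₁ ih₂ =>
    obtain ⟨h, hp, hcol, ⟨f⟩⟩ := ih₁
    obtain ⟨k, kp, kcol, ⟨g⟩⟩ := ih₂
    refine ⟨max h k, hp.append hw₁.count_eq kp, ?_, ?_⟩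
    · rw [disjUnion_eq_sum]
      exact hcol.sum_max kcol
    · rw [disjUnion_eq_sum]
      rcases le_total h k with hhk | hhk
      · rw [max_eq_right hhk]
        exact ⟨SimpleGraph.Embedding.sumInr.toHom.comp g⟩
      · rw [max_eq_left hhk]
        exact ⟨SimpleGraph.Embedding.sumInl.toHom.comp f⟩

theorem matchCount_pos_iff {V : Type*} [Finite V] {G : SimpleGraph V} {k : ℕ} :
    0 < matchCount G k ↔ ∃ s : Finset (Sym2 V), s.card = k ∧ (∀ e ∈ s, e ∈ G.edgeSet) ∧
      ∀ e ∈ s, ∀ f ∈ s, e ≠ f → ∀ v : V, v ∈ e → v ∉ f := by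
  rw [matchCount, Nat.card_pos_iff]
  exact ⟨fun h => nonempty_subtype.1 h.1, fun h => ⟨nonempty_subtype.2 h, inferInstance⟩⟩

theorem le_card_of_matchCount_pos {V : Type*} [Finite V] {G : SimpleGraph V} {k : ℕ}
    (hk : 0 < matchCount G k) (C : Finset V) (hC : ∀ e ∈ G.edgeSet, ∃ v ∈ C, v ∈ e) :
    k ≤ C.card := by
  obtain ⟨s, rfl, hs, hdisj⟩ := matchCount_pos_iff.1 hk
  choose c hcC hce using fun e : s => hC e (hs e e.2)
  rw [← s.card_attach]
  refine Finset.card_le_card_of_injOn c (fun e _ => hcC e) fun e _ f _ hef => ?_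
  by_contra hne
  exact hdisj e e.2 f f.2 (fun h => hne (Subtype.ext h)) (c e) (hce e) (hef ▸ hce f)

theorem bipGraph_adj_inl_inr {w : List Bool} {i j : Fin (w.count true)} :
    (bipGraph w).Adj (Sum.inl i) (Sum.inr j) ↔ xsBefore w (i + 1) < j + 1 := by
  simp [bipGraph, SimpleGraph.fromRel_adj]

theorem matchNumber_bipGraph_of_pathHeight {w : List Bool} {h : ℕ} (hw : PathHeight w h) :
    matchNumber (bipGraph w) = w.count true - h := by
  obtain ⟨hle, i, hi, hieq⟩ := hw
  refine IsGreatest.csSup_eq ⟨?_, fun k hk => ?_⟩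
  · let e : Fin (w.count true - h) → Sym2 (Fin (w.count true) ⊕ Fin (w.count true)) := fun j =>
      s(Sum.inl ⟨j, by omega⟩, Sum.inr ⟨j + h, by omega⟩)
    have he : Function.Injective e := fun a b hab => by
      simpa [e, Fin.ext_iff] using hab
    refine matchCount_pos_iff.2 ⟨Finset.univ.map ⟨e, he⟩, by simp, ?_, ?_⟩
    · simp only [Finset.mem_map, Finset.mem_univ, true_and, Function.Embedding.coeFn_mk,
        forall_exists_index, forall_apply_eq_imp_iff]
      intro j
      have := hle j (by omega)
      exact bipGraph_adj_inl_inr.2 (by simp only; omega)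
    · simp only [Finset.mem_map, Finset.mem_univ, true_and, Function.Embedding.coeFn_mk,
        forall_exists_index, forall_apply_eq_imp_iff]
      intro a b hab v hva hvb
      apply hab
      congr 1
      simp only [e, Sym2.mem_iff] at hva hvb
      rcases hva with rfl | rfl <;> simpa [Fin.ext_iff] using hvb
  · have hin : i + h ≤ w.count true := hieq ▸ xsBefore_le_count w (i + 1)
    let C : Finset (Fin (w.count true) ⊕ Fin (w.count true)) :=
      (Finset.univ.filter fun a : Fin (w.count true) => (a : ℕ) < i).disjSum
        (Finset.univ.filter fun a : Fin (w.count true) => i + h ≤ (a : ℕ))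
    have hcover : ∀ a b : Fin (w.count true), xsBefore w (a + 1) < b + 1 →
        (a : ℕ) < i ∨ i + h ≤ (b : ℕ) := fun a b hab => by
      by_contra! hcon
      have := monotone_xsBefore w (Nat.add_le_add_right hcon.1 1)
      omega
    refine (le_card_of_matchCount_pos hk C fun e he => ?_).trans ?_
    · induction e using Sym2.ind with
      | _ a b =>
      obtain ⟨-, ⟨a, b, rfl, rfl, hab⟩ | ⟨a, b, rfl, rfl, hab⟩⟩ := he
      all_goals
        rcases hcover a b hab with h' | h'
        · exact ⟨Sum.inl a, by simpa [C] using h', by simp⟩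
        · exact ⟨Sum.inr b, by simpa [C] using h', by simp⟩
    · have h₁ : (Finset.univ.filter fun a : Fin (w.count true) => (a : ℕ) < i).card ≤
          (Finset.range i).card :=
        Finset.card_le_card_of_injOn Fin.val (fun a ha => by simpa using ha)
          Fin.val_injective.injOn
      have h₂ : (Finset.univ.filter fun a : Fin (w.count true) => i + h ≤ (a : ℕ)).card ≤
          (Finset.Ico (i + h) (w.count true)).card :=
        Finset.card_le_card_of_injOn Fin.val (fun a ha => by simpa using ha)
          Fin.val_injective.injOn
      rw [Finset.card_range] at h₁
      rw [Nat.card_Ico] at h₂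
      rw [Finset.card_disjSum]
      omega

theorem chromaticNumber_eq_of_colorable_of_hom {V : Type*} {G : SimpleGraph V} {h : ℕ}
    (hcol : G.Colorable h) (hom : Nonempty ((⊤ : SimpleGraph (Fin h)) →g G)) :
    G.chromaticNumber = h := by
  obtain ⟨f⟩ := hom
  refine le_antisymm hcol.chromaticNumber_le ?_
  have := SimpleGraph.chromaticNumber_mono_of_hom f
  simpa [SimpleGraph.chromaticNumber_top] using this

/-- If `w` is a Dyck word with `n` `x`'s whose associated graph `G_w` is the quasi-threshold
graph `G` on `n` vertices, then the matching number of the bipartite graph `Γ_w` equals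
`n − χ(G)`. -/
theorem matchNumber_bipGraph (w : List Bool) (hw : IsDyck w) (n : ℕ)
    (hn : w.count true = n) (V : Type) [Fintype V] (G : SimpleGraph V)
    (hG : IsQuasiThreshold G) (hcard : Fintype.card V = n) (hwG : WordGraph w V G) :
    matchNumber (bipGraph w) = n - G.chromaticNumber.toNat := by
  obtain ⟨h, hp, hcol, hom⟩ := hwG.exists_pathHeight
  rw [matchNumber_bipGraph_of_pathHeight hp, chromaticNumber_eq_of_colorable_of_hom hcol hom, hn]
  rfl
end

section
/- Let w be a Dyck word with n x's and let T_w = {(a_1,b_1), …, (a_t,b_t)} be the set of labels of unit squares that the Dyck path of w turns around. Then vertices i < j are adjacent in the graph H_w if and only if there is some s with a_s ≤ i < j ≤ b_s; in particular, each set {a_s, a_s+1, …, b_s} is a clique of H_w and these cliques cover all edges of H_w. -/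
/-- The Dyck path of `w` turns around the unit square labelled `(a,b)` if it steps from
`(a−1, b−1)` to `(a−1, b)` (a step up, i.e. an `x`) and then to `(a, b)` (a step right, i.e.
a `D`). -/
def TurnsAround (w : List Bool) (a b : ℕ) : Prop :=
  ∃ p : ℕ, (w.take p).count false + 1 = a ∧ (w.take p).count true + 1 = b ∧
    w[p]? = some true ∧ w[p + 1]? = some false

/-- A prefix containing fewer than `i` `D`'s has at most `xsBefore w i` `x`'s. -/
theorem count_true_take_le_xsBefore (w : List Bool) (i p : ℕ)
    (h : (w.take p).count false < i) : (w.take p).count true ≤ xsBefore w i := by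
  induction w generalizing i p with
  | nil => simp
  | cons c w ih =>
    obtain ⟨i, rfl⟩ : ∃ k, i = k + 1 := ⟨i - 1, by omega⟩
    cases p with
    | zero => simp
    | succ p =>
      cases c with
      | true =>
        simp only [List.take_succ_cons, List.count_cons, xsBefore] at h ⊢
        simpa using ih (i + 1) p (by simpa using h)
      | false =>
        simp only [List.take_succ_cons, List.count_cons, xsBefore] at h ⊢
        have hlt : (w.take p).count false < i := by simpa using h
        have hi0 : i ≠ 0 := by omega
        simpa [hi0] using ih i p hlt

/-- The last `x` run before the `i`-th `D` ends in a square that the path turns around, at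
height `xsBefore w i`. -/
theorem exists_turnsAround_xsBefore (w : List Bool) (i : ℕ) (hi : i ≤ w.count false)
    (hpos : 0 < xsBefore w i) : ∃ a ≤ i, TurnsAround w a (xsBefore w i) := by
  induction w generalizing i with
  | nil => simp [xsBefore] at hpos
  | cons c w ih =>
    cases i with
    | zero => simp [xsBefore] at hpos
    | succ i =>
      cases c with
      | true =>
        rcases Nat.eq_zero_or_pos (xsBefore w (i + 1)) with h0 | h0
        · refine ⟨1, by omega, 0, by simp, by simp [xsBefore, h0], by simp, ?_⟩
          match w with
          | [] => simp at hi
          | true :: v => simp [xsBefore] at h0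
          | false :: v => simp
        · obtain ⟨a, ha, p, hp, hb, h1, h2⟩ := ih (i + 1) (by simpa using hi) h0
          exact ⟨a, ha, p + 1, by simpa using hp, by simp [xsBefore, ← hb],
            by simpa using h1, by simpa using h2⟩
      | false =>
        have hi0 : i ≠ 0 := by rintro rfl; simp [xsBefore] at hpos
        simp only [xsBefore, if_neg hi0] at hpos ⊢
        obtain ⟨a, ha, p, hp, hb, h1, h2⟩ := ih i (by simpa using hi) hpos
        exact ⟨a + 1, by omega, p + 1, by simpa using hp, by simpa using hb,
          by simpa using h1, by simpa using h2⟩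

/-- A square that the path turns around bounds `xsBefore` from below. -/
theorem TurnsAround.le_xsBefore {w : List Bool} {a b i : ℕ} (h : TurnsAround w a b)
    (hi : a ≤ i) : b ≤ xsBefore w i := by
  obtain ⟨p, hp, hb, h1, -⟩ := h
  have := count_true_take_le_xsBefore w i (p + 1)
  simp [List.take_add_one, h1] at this
  omega

theorem cliqueUnionGraph_adj_iff_le_xsBefore {w : List Bool} {i j : Fin (w.count true)}
    (hij : (i : ℕ) < j) :
    (cliqueUnionGraph w).Adj i j ↔ (j : ℕ) + 1 ≤ xsBefore w ((i : ℕ) + 1) := by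
  have hne : i ≠ j := by rintro rfl; exact lt_irrefl _ hij
  have hlt : i < j := hij
  simp [cliqueUnionGraph, hne, hlt, hlt.not_gt]

/-- Vertices with labels `i < j` are adjacent in `H_w` iff `a ≤ i < j ≤ b` for some square
`(a,b)` that the Dyck path of `w` turns around; in particular each segment `{a, …, b}` with
`(a,b)` turned around is a clique of `H_w`, and these cliques cover all edges of `H_w`.
(Vertex `i : Fin n` carries the label `i + 1`.) -/
theorem cliqueUnionGraph_adj_iff_turnsAround (w : List Bool) (hw : IsDyck w) :
    (∀ i j : Fin (w.count true), (i : ℕ) < (j : ℕ) →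
      ((cliqueUnionGraph w).Adj i j ↔
        ∃ a b : ℕ, TurnsAround w a b ∧ a ≤ (i : ℕ) + 1 ∧ (j : ℕ) + 1 ≤ b)) ∧
    (∀ a b : ℕ, TurnsAround w a b → ∀ i j : Fin (w.count true),
      a ≤ (i : ℕ) + 1 → (i : ℕ) < (j : ℕ) → (j : ℕ) + 1 ≤ b →
        (cliqueUnionGraph w).Adj i j) := by
  constructor
  · intro i j hij
    rw [cliqueUnionGraph_adj_iff_le_xsBefore hij]
    constructor
    · intro h
      obtain ⟨a, ha, hab⟩ := exists_turnsAround_xsBefore w ((i : ℕ) + 1)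
        (by have := i.isLt; have := hw.1; omega) (by omega)
      exact ⟨a, _, hab, ha, h⟩
    · rintro ⟨a, b, hab, ha, hb⟩
      exact hb.trans (hab.le_xsBefore ha)
  · intro a b hab i j ha hij hb
    exact (cliqueUnionGraph_adj_iff_le_xsBefore hij).2 (hb.trans (hab.le_xsBefore ha))
end

section
/- (Levy criterion) For each n let s_n = (a_{n,k})_{k ∈ ℤ} be a sequence of non-negative reals, supported on a finite subset of the non-negative integers with 0 < Σ_k a_{n,k}, and suppose the generating polynomial Σ_{k} a_{n,k} x^k has only real zeros. Let X_n be the ℤ-valued random variable with P(X_n = k) = a_{n,k}/Σ_j a_{n,j}, with mean μ_n and standard deviation σ_n. If σ_n → ∞ as n → ∞, then s_n is asymptotically normal: for every real x, P((X_n − μ_n)/σ_n ≤ x) → P(Z ≤ x) as n → ∞, where Z is a standard normal random variable. -/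
open MeasureTheory ProbabilityTheory Filter Topology Polynomial

/-- Telescoping bound for products of numbers in the closed unit disc. -/
theorem norm_multiset_prod_sub_prod_le_s19 {ι : Type*} (m : Multiset ι) (f g : ι → ℂ)
    (hf : ∀ i ∈ m, ‖f i‖ ≤ 1) (hg : ∀ i ∈ m, ‖g i‖ ≤ 1) :
    ‖(m.map f).prod‖ ≤ 1 ∧
      ‖(m.map f).prod - (m.map g).prod‖ ≤ (m.map fun i => ‖f i - g i‖).sum := by
  induction m using Multiset.induction_on with
  | empty => simp
  | cons i m ih =>
    obtain ⟨ih₁, ih₂⟩ := ih (fun j hj => hf j (Multiset.mem_cons_of_mem hj))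
      (fun j hj => hg j (Multiset.mem_cons_of_mem hj))
    have hfi := hf i (Multiset.mem_cons_self i m)
    have hgi := hg i (Multiset.mem_cons_self i m)
    simp only [Multiset.map_cons, Multiset.prod_cons, Multiset.sum_cons]
    constructor
    · rw [norm_mul]
      exact mul_le_one₀ hfi (norm_nonneg _) ih₁
    · have hsplit : f i * (m.map f).prod - g i * (m.map g).prod
          = (f i - g i) * (m.map f).prod + g i * ((m.map f).prod - (m.map g).prod) := by ring
      rw [hsplit]
      refine (norm_add_le _ _).trans ?_
      rw [norm_mul, norm_mul]
      gcongr
      · exact mul_le_of_le_one_right (norm_nonneg _) ih₁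
      · exact (mul_le_of_le_one_left (norm_nonneg _) hgi).trans ih₂

/-- The characteristic function of a centered Bernoulli variable of parameter `p`. -/
noncomputable def centeredBernoulliCharFun (p u : ℝ) : ℂ :=
  (1 - p) * Complex.exp (-(u * p) * Complex.I) + p * Complex.exp (u * (1 - p) * Complex.I)

theorem norm_centeredBernoulliCharFun_le_one {p : ℝ} (hp₀ : 0 ≤ p) (hp₁ : p ≤ 1) (u : ℝ) :
    ‖centeredBernoulliCharFun p u‖ ≤ 1 := by
  have h₁ : ‖Complex.exp (-(u * p) * Complex.I)‖ = 1 := by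
    exact_mod_cast Complex.norm_exp_ofReal_mul_I (-(u * p))
  have h₂ : ‖Complex.exp (u * (1 - p) * Complex.I)‖ = 1 := by
    exact_mod_cast Complex.norm_exp_ofReal_mul_I (u * (1 - p))
  have h₃ : ‖(1 - p : ℂ)‖ = 1 - p := by
    have := Complex.norm_of_nonneg (sub_nonneg.2 hp₁)
    exact_mod_cast this
  refine (norm_add_le _ _).trans ?_
  rw [norm_mul, norm_mul, h₁, h₂, h₃, Complex.norm_of_nonneg hp₀]
  linarith

theorem norm_exp_mul_I_sub_taylor_le {x : ℝ} (hx : |x| ≤ 1) :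
    ‖Complex.exp (x * Complex.I) - (1 + x * Complex.I - x ^ 2 / 2)‖ ≤ |x| ^ 3 := by
  have hn : ‖(x * Complex.I : ℂ)‖ = |x| := by simp
  have h := Complex.exp_bound (x := x * Complex.I) (by rw [hn]; exact hx) (n := 3) (by norm_num)
  rw [hn] at h
  have hs : ∑ j ∈ Finset.range 3, (x * Complex.I : ℂ) ^ j / (j.factorial : ℂ)
      = 1 + x * Complex.I - x ^ 2 / 2 := by
    simp only [Finset.sum_range_succ, Finset.sum_range_zero, mul_pow, Complex.I_sq]
    norm_num [Nat.factorial]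
    ring
  rw [hs] at h
  refine h.trans (mul_le_of_le_one_right (by positivity) ?_)
  norm_num [Nat.factorial]

theorem norm_exp_neg_sub_one_add_le {y : ℝ} (hy : |y| ≤ 1) :
    ‖Complex.exp (-y) - (1 - y)‖ ≤ y ^ 2 := by
  have h := Complex.exp_bound (x := -y) (by simpa using hy) (n := 2) (by norm_num)
  have hs : ∑ j ∈ Finset.range 2, (-y : ℂ) ^ j / (j.factorial : ℂ) = 1 - y := by
    simp only [Finset.sum_range_succ, Finset.sum_range_zero]
    norm_num [Nat.factorial]
    ring
  rw [hs, norm_neg, Complex.norm_real, Real.norm_eq_abs, sq_abs] at h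
  refine h.trans (mul_le_of_le_one_right (by positivity) ?_)
  norm_num [Nat.factorial]

theorem norm_centeredBernoulliCharFun_sub_exp_le {p u : ℝ} (hp₀ : 0 ≤ p) (hp₁ : p ≤ 1)
    (hu : |u| ≤ 1) :
    ‖centeredBernoulliCharFun p u - Complex.exp (-(p * (1 - p) * u ^ 2 / 2 : ℝ))‖
      ≤ 2 * |u| ^ 3 * (p * (1 - p)) := by
  have hq₀ : 0 ≤ 1 - p := by linarith
  have hv₀ : 0 ≤ p * (1 - p) := mul_nonneg hp₀ hq₀
  have hu₀ := abs_nonneg u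
  have hx₁ : |(-(u * p))| = |u| * p := by rw [abs_neg, abs_mul, abs_of_nonneg hp₀]
  have hx₂ : |u * (1 - p)| = |u| * (1 - p) := by rw [abs_mul, abs_of_nonneg hq₀]
  have h₁ := norm_exp_mul_I_sub_taylor_le (x := -(u * p)) (by rw [hx₁]; nlinarith)
  have h₂ := norm_exp_mul_I_sub_taylor_le (x := u * (1 - p)) (by rw [hx₂]; nlinarith)
  have hu2 : u ^ 2 ≤ 1 := by rw [← sq_abs]; nlinarith
  have hv₁ : p * (1 - p) ≤ 1 := by nlinarith
  have hvu : p * (1 - p) * u ^ 2 ≤ 1 := mul_le_one₀ hv₁ (sq_nonneg u) hu2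
  have h₃ := norm_exp_neg_sub_one_add_le (y := p * (1 - p) * u ^ 2 / 2)
    (by rw [abs_of_nonneg (by positivity)]; linarith)
  rw [hx₁] at h₁
  rw [hx₂] at h₂
  set e₁ := Complex.exp (((-(u * p) : ℝ) : ℂ) * Complex.I) -
    (1 + ((-(u * p) : ℝ) : ℂ) * Complex.I - ((-(u * p) : ℝ) : ℂ) ^ 2 / 2) with he₁
  set e₂ := Complex.exp (((u * (1 - p) : ℝ) : ℂ) * Complex.I) -
    (1 + ((u * (1 - p) : ℝ) : ℂ) * Complex.I - ((u * (1 - p) : ℝ) : ℂ) ^ 2 / 2) with he₂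
  set e₃ := Complex.exp (-((p * (1 - p) * u ^ 2 / 2 : ℝ) : ℂ)) -
    (1 - ((p * (1 - p) * u ^ 2 / 2 : ℝ) : ℂ)) with he₃
  have hdecomp : centeredBernoulliCharFun p u - Complex.exp (-(p * (1 - p) * u ^ 2 / 2 : ℝ))
      = ((1 - p : ℝ) : ℂ) * e₁ + (p : ℂ) * e₂ - e₃ := by
    rw [he₁, he₂, he₃, centeredBernoulliCharFun]
    push_cast
    ring
  rw [hdecomp]
  refine (norm_sub_le_of_le (norm_add_le _ _) le_rfl).trans ?_
  rw [norm_mul, norm_mul, Complex.norm_of_nonneg hp₀, Complex.norm_of_nonneg hq₀]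
  have hu3 : 0 ≤ |u| ^ 3 := by positivity
  have b₁ : (1 - p) * ‖e₁‖ ≤ (1 - p) * (|u| * p) ^ 3 := by gcongr
  have b₂ : p * ‖e₂‖ ≤ p * (|u| * (1 - p)) ^ 3 := by gcongr
  have b₃ : ‖e₃‖ ≤ |u| ^ 3 * (p * (1 - p)) := by
    refine h₃.trans ?_
    have hu4 : u ^ 4 ≤ |u| ^ 3 := by
      have : u ^ 4 = |u| ^ 3 * |u| := by rw [← pow_succ]; exact (Even.pow_abs (by decide) u).symm
      rw [this]
      exact mul_le_of_le_one_right hu3 hu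
    have h4 : 0 ≤ u ^ 4 := by positivity
    calc (p * (1 - p) * u ^ 2 / 2) ^ 2 = (p * (1 - p)) * (p * (1 - p)) * u ^ 4 / 4 := by ring
      _ ≤ 1 * (p * (1 - p)) * |u| ^ 3 / 1 := by gcongr; norm_num
      _ = |u| ^ 3 * (p * (1 - p)) := by ring
  have hpq : p ^ 2 + (1 - p) ^ 2 ≤ 1 := by nlinarith
  have b₁₂ : (1 - p) * (|u| * p) ^ 3 + p * (|u| * (1 - p)) ^ 3 ≤ |u| ^ 3 * (p * (1 - p)) := by
    calc (1 - p) * (|u| * p) ^ 3 + p * (|u| * (1 - p)) ^ 3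
        = |u| ^ 3 * (p * (1 - p)) * (p ^ 2 + (1 - p) ^ 2) := by ring
      _ ≤ |u| ^ 3 * (p * (1 - p)) := mul_le_of_le_one_right (by positivity) hpq
  linarith

/-- Lyapunov-type estimate: a product of centered Bernoulli characteristic functions is close to
the Gaussian with the same variance. -/
theorem norm_prod_centeredBernoulliCharFun_sub_exp_le (m : Multiset ℝ)
    (hm : ∀ p ∈ m, 0 ≤ p ∧ p ≤ 1) {u : ℝ} (hu : |u| ≤ 1) :
    ‖(m.map fun p => centeredBernoulliCharFun p u).prod -
        Complex.exp (-((m.map fun p => p * (1 - p)).sum * u ^ 2 / 2 : ℝ))‖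
      ≤ 2 * |u| ^ 3 * (m.map fun p => p * (1 - p)).sum := by
  have hexp : Complex.exp (-((m.map fun p => p * (1 - p)).sum * u ^ 2 / 2 : ℝ))
      = (m.map fun p => Complex.exp (-(p * (1 - p) * u ^ 2 / 2 : ℝ))).prod := by
    induction m using Multiset.induction_on with
    | empty => simp
    | cons p m ih =>
      have ih' := ih fun q hq => hm q (Multiset.mem_cons_of_mem hq)
      simp only [Multiset.map_cons, Multiset.prod_cons, Multiset.sum_cons, ← ih', ← Complex.exp_add]
      congr 1
      push_cast
      ring
  rw [hexp, ← Multiset.sum_map_mul_left]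
  refine (norm_multiset_prod_sub_prod_le_s19 m _ _
    (fun p hp => norm_centeredBernoulliCharFun_le_one (hm p hp).1 (hm p hp).2 u)
    (fun p hp => ?_)).2.trans ?_
  · rw [← Complex.ofReal_neg, Complex.norm_exp_ofReal, Real.exp_le_one_iff]
    have := mul_nonneg (hm p hp).1 (sub_nonneg.2 (hm p hp).2)
    have : 0 ≤ p * (1 - p) * u ^ 2 / 2 := by positivity
    linarith
  · exact Multiset.sum_map_le_sum_map _ _ fun p hp =>
      norm_centeredBernoulliCharFun_sub_exp_le (hm p hp).1 (hm p hp).2 hu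

/-- The probability generating polynomial of a sum of independent Bernoulli variables with
parameters in `m`. -/
noncomputable def bernoulliSumPoly (m : Multiset ℝ) : ℝ[X] :=
  (m.map fun p => C p * X + C (1 - p)).prod

theorem bernoulliSumPoly_moments (m : Multiset ℝ) :
    (bernoulliSumPoly m).eval 1 = 1 ∧
      (derivative (bernoulliSumPoly m)).eval 1 = m.sum ∧
      (derivative (derivative (bernoulliSumPoly m))).eval 1 + m.sum - m.sum ^ 2 =
        (m.map fun p => p * (1 - p)).sum := by
  unfold bernoulliSumPoly
  induction m using Multiset.induction_on with
  | empty => simp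
  | cons p m ih =>
    obtain ⟨h₀, h₁, h₂⟩ := ih
    simp only [Multiset.map_cons, Multiset.prod_cons, Multiset.sum_cons, derivative_mul,
      derivative_add, derivative_C, derivative_X, eval_add, eval_mul, eval_C, eval_X, h₀, h₁,
      zero_mul, mul_one, add_zero, zero_add] at h₂ ⊢
    refine ⟨by ring, by ring, ?_⟩
    rw [← h₂]
    ring

/-- A polynomial with non-negative coefficients, value `1` at `1` and only real zeros is the
generating polynomial of a sum of independent Bernoulli variables. -/
theorem exists_eq_bernoulliSumPoly {P : ℝ[X]} (hcoeff : ∀ k, 0 ≤ P.coeff k)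
    (hone : P.eval 1 = 1) (hreal : ∀ z : ℂ, aeval z P = 0 → z.im = 0) :
    ∃ m : Multiset ℝ, (∀ p ∈ m, 0 ≤ p ∧ p ≤ 1) ∧ P = bernoulliSumPoly m := by
  have hP : P ≠ 0 := by
    rintro rfl
    simp at hone
  have hsplit : P.Splits := by
    refine Splits.of_splits_map (algebraMap ℝ ℂ) (IsAlgClosed.splits _) fun z hz => ?_
    have hz' : aeval z P = 0 := by
      rw [aeval_def, ← eval_map]
      exact (mem_roots'.1 hz).2
    exact ⟨z.re, Complex.ext rfl (hreal z hz').symm⟩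
  have hroots : ∀ r ∈ P.roots, r ≤ 0 := by
    intro r hr
    by_contra! hpos
    have heval : P.eval r = 0 := (mem_roots'.1 hr).2
    rw [eval_eq_sum_range] at heval
    have hlead : 0 < P.leadingCoeff :=
      lt_of_le_of_ne (hcoeff _) (leadingCoeff_ne_zero.2 hP).symm
    have hge := Finset.single_le_sum (f := fun i => P.coeff i * r ^ i)
      (fun i _ => mul_nonneg (hcoeff i) (by positivity)) (Finset.self_mem_range_succ P.natDegree)
    rw [heval] at hge
    have : 0 < P.coeff P.natDegree * r ^ P.natDegree := mul_pos hlead (by positivity)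
    linarith
  refine ⟨P.roots.map fun r => (1 - r)⁻¹, ?_, ?_⟩
  · intro p hp
    obtain ⟨r, hr, rfl⟩ := Multiset.mem_map.1 hp
    have := hroots r hr
    exact ⟨inv_nonneg.2 (by linarith), inv_le_one_of_one_le₀ (by linarith)⟩
  · have hval : P.leadingCoeff * (P.roots.map fun r => 1 - r).prod = 1 := by
      rw [← hsplit.eval_eq_prod_roots, hone]
    have hfac : bernoulliSumPoly (P.roots.map fun r => (1 - r)⁻¹)
        = (P.roots.map fun r => C ((1 - r)⁻¹) * (X - C r)).prod := by
      rw [bernoulliSumPoly, Multiset.map_map]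
      congr 1
      refine Multiset.map_congr rfl fun r hr => ?_
      have hne : 1 - r ≠ 0 := by have := hroots r hr; linarith
      have hc : 1 - (1 - r)⁻¹ = -((1 - r)⁻¹ * r) := by
        field_simp
        ring
      simp only [Function.comp, hc, C_neg, C_mul]
      ring
    have hinv : (P.roots.map fun r => C ((1 - r)⁻¹)).prod = C P.leadingCoeff := by
      have : (P.roots.map fun r => C ((1 - r)⁻¹)).prod
          = C ((P.roots.map fun r => 1 - r).prod)⁻¹ := by
        rw [← Multiset.prod_map_inv, map_multiset_prod, Multiset.map_map]
        rfl
      rw [this]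
      congr 1
      exact (eq_inv_of_mul_eq_one_left hval).symm
    rw [hfac, Multiset.prod_map_mul, hinv]
    exact hsplit.eq_prod_roots

theorem seqPMF_nonneg {a : ℤ → ℝ} (ha : ∀ k, 0 ≤ a k) (k : ℤ) : 0 ≤ seqPMF a k :=
  div_nonneg (ha k) (finsum_nonneg ha)

theorem finsum_mul_seqPMF {a : ℤ → ℝ} (hfin : (Function.support a).Finite) (f : ℤ → ℝ) :
    ∑ᶠ k, f k * seqPMF a k = ∑ k ∈ hfin.toFinset, f k * seqPMF a k := by
  refine finsum_eq_sum_of_support_subset _ fun k hk => ?_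
  simp only [Set.Finite.coe_toFinset, Function.mem_support] at hk ⊢
  rintro h
  simp [seqPMF, h] at hk

theorem sum_seqPMF {a : ℤ → ℝ} (hfin : (Function.support a).Finite) (hpos : 0 < seqTotal a) :
    ∑ k ∈ hfin.toFinset, seqPMF a k = 1 := by
  simp only [seqPMF]
  rw [← Finset.sum_div, ← finsum_eq_sum a hfin]
  exact div_self hpos.ne'

/-- The decomposition of a sequence with real-rooted generating polynomial as a sum of independent
Bernoulli variables, expressed through its generating function, mean and variance. -/
theorem exists_bernoulli_parameters {a : ℤ → ℝ} (hnonneg : ∀ k, 0 ≤ a k)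
    (hneg : ∀ k : ℤ, k < 0 → a k = 0) (hfin : (Function.support a).Finite)
    (hpos : 0 < seqTotal a)
    (hroots : ∀ z : ℂ, aeval z (∑ᶠ k : ℤ, a k • (X : ℝ[X]) ^ k.toNat) = 0 → z.im = 0) :
    ∃ m : Multiset ℝ, (∀ p ∈ m, 0 ≤ p ∧ p ≤ 1) ∧
      (∀ z : ℂ, ∑ k ∈ hfin.toFinset, (seqPMF a k : ℂ) * z ^ k.toNat =
        (m.map fun p : ℝ => (p * z + (1 - p) : ℂ)).prod) ∧
      seqMean a = m.sum ∧ seqStdDev a ^ 2 = (m.map fun p => p * (1 - p)).sum := by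
  set S := hfin.toFinset with hS
  set P : ℝ[X] := ∑ k ∈ S, C (seqPMF a k) * X ^ k.toNat with hPdef
  have hcast : ∀ k ∈ S, ((k.toNat : ℕ) : ℝ) = (k : ℝ) := by
    intro k hk
    have hk0 : 0 ≤ k := by
      by_contra! h
      exact (hfin.mem_toFinset.1 hk) (hneg k h)
    exact_mod_cast Int.toNat_of_nonneg hk0
  have hone : P.eval 1 = 1 := by
    rw [hPdef, eval_finsetSum]
    simpa using sum_seqPMF hfin hpos
  have hcoeff : ∀ k, 0 ≤ P.coeff k := by
    intro k
    rw [hPdef, finsetSum_coeff]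
    refine Finset.sum_nonneg fun j _ => ?_
    rw [coeff_C_mul, coeff_X_pow]
    exact mul_nonneg (seqPMF_nonneg hnonneg j) (by split_ifs <;> norm_num)
  have hgen : (∑ᶠ k : ℤ, a k • (X : ℝ[X]) ^ k.toNat) = C (seqTotal a) * P := by
    rw [finsum_eq_sum_of_support_subset (s := S), hPdef, Finset.mul_sum]
    · refine Finset.sum_congr rfl fun k _ => ?_
      rw [← mul_assoc, ← C_mul, seqPMF, mul_div_cancel₀ _ hpos.ne', smul_eq_C_mul]
    · intro k hk
      rw [hS, Set.Finite.coe_toFinset]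
      rintro h
      simp [h] at hk
  obtain ⟨m, hm, hPm⟩ := exists_eq_bernoulliSumPoly hcoeff hone fun z hz =>
    hroots z (by rw [hgen, map_mul, hz, mul_zero])
  obtain ⟨-, hd₁, hd₂⟩ := bernoulliSumPoly_moments m
  have hmean : seqMean a = m.sum := by
    rw [← hd₁, ← hPm, seqMean, finsum_mul_seqPMF hfin, hPdef, derivative_sum, eval_finsetSum]
    refine Finset.sum_congr rfl fun k hk => ?_
    rw [← hcast k hk, derivative_C_mul, derivative_X_pow]
    simp only [eval_mul, eval_C, eval_pow, eval_X, one_pow, mul_one, mul_comm]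
  refine ⟨m, hm, fun z => ?_, hmean, ?_⟩
  · have h : aeval z P = aeval z (bernoulliSumPoly m) := by rw [hPm]
    rw [hPdef, bernoulliSumPoly, map_sum, map_multiset_prod, Multiset.map_map] at h
    simpa [Function.comp_def] using h
  · have hsecond : (derivative (derivative P)).eval 1
        = ∑ k ∈ S, ((k : ℝ) ^ 2 - k) * seqPMF a k := by
      rw [hPdef, derivative_sum, derivative_sum, eval_finsetSum]
      refine Finset.sum_congr rfl fun k hk => ?_
      rw [← hcast k hk]
      rcases Nat.eq_zero_or_pos k.toNat with h0 | h0
      · simp [h0]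
      · simp [derivative_X_pow, Nat.cast_sub (Nat.succ_le_of_lt h0)]
        ring
    have hfirst : ∑ k ∈ S, (k : ℝ) * seqPMF a k = m.sum := by
      rw [← hmean, seqMean, finsum_mul_seqPMF hfin]
    rw [seqStdDev, Real.sq_sqrt (finsum_nonneg fun k =>
      mul_nonneg (sq_nonneg _) (seqPMF_nonneg hnonneg k)), finsum_mul_seqPMF hfin, ← hd₂, ← hPm,
      hsecond, hmean]
    have hexpand : ∀ k ∈ S, ((k : ℝ) - m.sum) ^ 2 * seqPMF a k
        = ((k : ℝ) ^ 2 - k) * seqPMF a k + (1 - 2 * m.sum) * ((k : ℝ) * seqPMF a k)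
          + m.sum ^ 2 * seqPMF a k := fun k _ => by ring
    rw [Finset.sum_congr rfl hexpand, Finset.sum_add_distrib, Finset.sum_add_distrib,
      ← Finset.mul_sum, ← Finset.mul_sum, hfirst, sum_seqPMF hfin hpos]
    ring

/-- The law of `(X - μ)/σ` for the random variable `X` with `P(X = k) = a k / Σ_j a j`. -/
noncomputable def seqNormalizedLaw (a : ℤ → ℝ) (hfin : (Function.support a).Finite) :
    Measure ℝ :=
  ∑ k ∈ hfin.toFinset,
    ENNReal.ofReal (seqPMF a k) • Measure.dirac (((k : ℝ) - seqMean a) / seqStdDev a)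

theorem isProbabilityMeasure_seqNormalizedLaw {a : ℤ → ℝ} (hnonneg : ∀ k, 0 ≤ a k)
    (hfin : (Function.support a).Finite) (hpos : 0 < seqTotal a) :
    IsProbabilityMeasure (seqNormalizedLaw a hfin) := by
  constructor
  rw [seqNormalizedLaw, Measure.finsetSum_apply]
  simp only [Measure.smul_apply, measure_univ, smul_eq_mul, mul_one]
  rw [← ENNReal.ofReal_sum_of_nonneg fun k _ => seqPMF_nonneg hnonneg k, sum_seqPMF hfin hpos,
    ENNReal.ofReal_one]

theorem toReal_seqNormalizedLaw_Iic {a : ℤ → ℝ} (hnonneg : ∀ k, 0 ≤ a k)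
    (hfin : (Function.support a).Finite) (x : ℝ) :
    (seqNormalizedLaw a hfin (Set.Iic x)).toReal = seqNormalizedCDF a x := by
  classical
  have hcdf : seqNormalizedCDF a x = ∑ᶠ k : ℤ,
      (if ((k : ℝ) - seqMean a) / seqStdDev a ≤ x then 1 else 0) * seqPMF a k := by
    rw [seqNormalizedCDF]
    refine finsum_congr fun k => ?_
    rw [finsum_eq_if]
    simp
  rw [hcdf, finsum_mul_seqPMF hfin, seqNormalizedLaw, Measure.finsetSum_apply,
    ENNReal.toReal_sum]
  · refine Finset.sum_congr rfl fun k _ => ?_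
    rw [Measure.smul_apply, Measure.dirac_apply' _ measurableSet_Iic, smul_eq_mul,
      ENNReal.toReal_mul, ENNReal.toReal_ofReal (seqPMF_nonneg hnonneg k), mul_comm]
    by_cases h : ((k : ℝ) - seqMean a) / seqStdDev a ≤ x <;> simp [h]
  · intro k _
    exact ENNReal.mul_ne_top ENNReal.ofReal_ne_top (measure_ne_top _ _)

theorem charFun_seqNormalizedLaw {a : ℤ → ℝ} (hnonneg : ∀ k, 0 ≤ a k)
    (hfin : (Function.support a).Finite) (t : ℝ) :
    charFun (seqNormalizedLaw a hfin) t = ∑ k ∈ hfin.toFinset, (seqPMF a k : ℂ) *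
      Complex.exp ((t / seqStdDev a : ℝ) * ((k : ℝ) - seqMean a : ℝ) * Complex.I) := by
  rw [charFun_apply_real, seqNormalizedLaw, integral_finsetSum_measure]
  · refine Finset.sum_congr rfl fun k _ => ?_
    rw [integral_smul_measure, integral_dirac, ENNReal.toReal_ofReal (seqPMF_nonneg hnonneg k),
      Complex.real_smul]
    congr 2
    push_cast
    ring
  · intro k _
    refine Integrable.smul_measure ?_ ENNReal.ofReal_ne_top
    exact integrable_dirac (by simp)

/-- Quantitative form of the criterion on the level of characteristic functions. -/
theorem norm_charFun_seqNormalizedLaw_sub_exp_le {a : ℤ → ℝ} (hnonneg : ∀ k, 0 ≤ a k)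
    (hneg : ∀ k : ℤ, k < 0 → a k = 0) (hfin : (Function.support a).Finite)
    (hpos : 0 < seqTotal a)
    (hroots : ∀ z : ℂ, aeval z (∑ᶠ k : ℤ, a k • (X : ℝ[X]) ^ k.toNat) = 0 → z.im = 0)
    {t : ℝ} (hσ : 0 < seqStdDev a) (ht : |t| ≤ seqStdDev a) :
    ‖charFun (seqNormalizedLaw a hfin) t - Complex.exp (-(t ^ 2 / 2 : ℝ))‖
      ≤ 2 * |t| ^ 3 / seqStdDev a := by
  obtain ⟨m, hm, hgen, hmean, hvar⟩ :=
    exists_bernoulli_parameters hnonneg hneg hfin hpos hroots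
  set σ := seqStdDev a with hσdef
  set u := t / σ with hu
  have habs : |u| = |t| / σ := by rw [hu, abs_div, abs_of_pos hσ]
  have hu1 : |u| ≤ 1 := by rw [habs]; exact (div_le_one hσ).2 ht
  have hchar : charFun (seqNormalizedLaw a hfin) t
      = (m.map fun p => centeredBernoulliCharFun p u).prod := by
    have hfac : ∀ n : Multiset ℝ, (n.map fun p => centeredBernoulliCharFun p u).prod =
        Complex.exp (-(u * n.sum : ℝ) * Complex.I) *
          (n.map fun p : ℝ => (p * Complex.exp (u * Complex.I) + (1 - p) : ℂ)).prod := by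
      intro n
      induction n using Multiset.induction_on with
      | empty => simp
      | cons p n ih =>
        simp only [Multiset.map_cons, Multiset.prod_cons, Multiset.sum_cons]
        rw [ih, centeredBernoulliCharFun]
        have h₁ : Complex.exp (-(u * (p + n.sum) : ℝ) * Complex.I) =
            Complex.exp (-(u * p) * Complex.I) * Complex.exp (-(u * n.sum : ℝ) * Complex.I) := by
          rw [← Complex.exp_add]
          congr 1
          push_cast
          ring
        have h₂ : Complex.exp (u * (1 - p) * Complex.I) =
            Complex.exp (-(u * p) * Complex.I) * Complex.exp (u * Complex.I) := by
          rw [← Complex.exp_add]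
          congr 1
          ring
        rw [h₁, h₂]
        ring
    rw [hfac, ← hgen, charFun_seqNormalizedLaw hnonneg hfin, hmean, ← hσdef, ← hu, Finset.mul_sum]
    refine Finset.sum_congr rfl fun k hk => ?_
    have hk0 : 0 ≤ k := by
      by_contra! h
      exact (hfin.mem_toFinset.1 hk) (hneg k h)
    have hcast : ((k.toNat : ℕ) : ℂ) = (k : ℂ) := by exact_mod_cast Int.toNat_of_nonneg hk0
    rw [← Complex.exp_nat_mul, hcast, mul_left_comm, ← Complex.exp_add]
    congr 2
    push_cast
    ring
  have hbound := norm_prod_centeredBernoulliCharFun_sub_exp_le m hm hu1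
  rw [← hvar, ← hchar] at hbound
  have h₁ : σ ^ 2 * u ^ 2 / 2 = t ^ 2 / 2 := by
    rw [hu]
    field_simp
  have h₂ : 2 * |u| ^ 3 * σ ^ 2 = 2 * |t| ^ 3 / σ := by
    rw [habs]
    field_simp
  rwa [h₁, h₂] at hbound

theorem toReal_gaussianReal_Iic (x : ℝ) :
    (gaussianReal 0 1 (Set.Iic x)).toReal = stdNormalCDF x := by
  rw [gaussianReal_apply_eq_integral _ one_ne_zero, ENNReal.toReal_ofReal
    (integral_nonneg fun t => gaussianPDFReal_nonneg 0 1 t), stdNormalCDF,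
    integral_Iic_eq_integral_Iio]
  refine integral_congr_ae (Eventually.of_forall fun t => ?_)
  simp [gaussianPDFReal, div_eq_inv_mul]

/-- The Levy criterion: if each finitely supported non-negative sequence `(a n k)_{k ∈ ℤ}`
(supported on the non-negative integers, with positive total) has a generating polynomial
with only real zeros, and the standard deviations tend to infinity, then the family is
asymptotically normal. -/
theorem levy_criterion (a : ℕ → ℤ → ℝ)
    (hnonneg : ∀ n k, 0 ≤ a n k)
    (hneg : ∀ n, ∀ k : ℤ, k < 0 → a n k = 0)
    (hfin : ∀ n, (Function.support (a n)).Finite)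
    (hpos : ∀ n, 0 < seqTotal (a n))
    (hroots : ∀ n, ∀ z : ℂ,
      Polynomial.aeval z (∑ᶠ k : ℤ, a n k • (Polynomial.X : Polynomial ℝ) ^ k.toNat) = 0 →
        z.im = 0)
    (hσ : Filter.Tendsto (fun n => seqStdDev (a n)) Filter.atTop Filter.atTop) :
    AsymptoticallyNormal a := by
  intro x
  let ν : ℕ → ProbabilityMeasure ℝ := fun n => ⟨seqNormalizedLaw (a n) (hfin n),
    isProbabilityMeasure_seqNormalizedLaw (hnonneg n) (hfin n) (hpos n)⟩
  let γ : ProbabilityMeasure ℝ := ⟨gaussianReal 0 1, inferInstance⟩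
  have hν : Tendsto ν atTop (𝓝 γ) := by
    refine ProbabilityMeasure.tendsto_of_tendsto_charFun fun t => ?_
    have hγ : charFun (γ : Measure ℝ) t = Complex.exp (-(t ^ 2 / 2 : ℝ)) := by
      change charFun (gaussianReal 0 1) t = _
      rw [charFun_gaussianReal]
      congr 1
      push_cast
      ring
    rw [hγ, tendsto_iff_norm_sub_tendsto_zero]
    refine squeeze_zero' (Eventually.of_forall fun _ => norm_nonneg _) ?_
      (hσ.const_div_atTop (2 * |t| ^ 3))
    filter_upwards [hσ.eventually_gt_atTop 0, hσ.eventually_ge_atTop |t|] with n hn hnt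
    exact norm_charFun_seqNormalizedLaw_sub_exp_le (hnonneg n) (hneg n) (hfin n) (hpos n)
      (hroots n) hn hnt
  have hnull : (γ : Measure ℝ) (frontier (Set.Iic x)) = 0 := by
    have : NullSingletonClass (γ : Measure ℝ) := nullSingletonClass_gaussianReal one_ne_zero
    rw [frontier_Iic]
    exact measure_singleton x
  have hlim := (ENNReal.tendsto_toReal (measure_ne_top (γ : Measure ℝ) (Set.Iic x))).comp
    (ProbabilityMeasure.tendsto_measure_of_null_frontier_of_tendsto' hν hnull)
  rw [show ((γ : Measure ℝ) (Set.Iic x)).toReal = stdNormalCDF x from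
    toReal_gaussianReal_Iic x] at hlim
  exact hlim.congr fun n => toReal_seqNormalizedLaw_Iic (hnonneg n) (hfin n) x
end
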